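/- Skew Peterson formula (combinatorial, simply-laced form): Let W be a simply-laced Weyl group, π a dominant integral weight, and let v < w be π-minuscule elements such that w v^{−1} is π′-minuscule for some dominant integral weight π′. Then #Red(w v^{−1}) = (ℓ(w) − ℓ(v))! / ∏_{β ∈ S(w/v)} ht(β). -/

import Mathlib

open scoped Classical BigOperators

/-- A bundled setting for a finite crystallographic root system together with its
Weyl group, its action on the rational span of the weight lattice, reflections,
and the data of coefficients of roots in the basis of simple roots. -/
structure WeylSetting where
  /-- index set of the Dynkin diagram (simple roots) -/
  I : Type
  [fintypeI : Fintype I]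
  [decEqI : DecidableEq I]
  /-- rational span of the weight lattice -/
  V : Type
  [acg : AddCommGroup V]
  [mod : Module ℚ V]
  /-- the Weyl group -/
  W : Type
  [grp : Group W]
  /-- the action of the Weyl group on weights -/
  act : W →* (V ≃ₗ[ℚ] V)
  /-- the simple roots -/
  simple : I → V
  /-- the (finite) set of roots -/
  roots : Finset V
  /-- `coroot β μ` is the pairing `⟨μ, β∨⟩` -/
  coroot : V → (V →ₗ[ℚ] ℚ)
  /-- the reflection `s_β ∈ W` associated to a root `β` -/
  srefl : V → W
  /-- coefficients of a positive root in the basis of simple roots -/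
  posCoeff : V → I → ℕ
  simple_mem : ∀ i, simple i ∈ roots
  simple_indep : LinearIndependent ℚ simple
  roots_neg : ∀ β ∈ roots, -β ∈ roots
  root_pos_or_neg : ∀ β ∈ roots,
    (∃ c : I → ℚ, (∀ i, 0 ≤ c i) ∧ β = ∑ i, c i • simple i) ∨
    (∃ c : I → ℚ, (∀ i, 0 ≤ c i) ∧ -β = ∑ i, c i • simple i)
  coroot_self : ∀ β ∈ roots, coroot β β = 2
  crystallographic : ∀ β ∈ roots, ∀ γ ∈ roots, ∃ n : ℤ, coroot β γ = n
  posCoeff_spec : ∀ β ∈ roots,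
    (∃ c : I → ℚ, (∀ i, 0 ≤ c i) ∧ β = ∑ i, c i • simple i) →
    β = ∑ i, (posCoeff β i : ℚ) • simple i
  srefl_apply : ∀ β ∈ roots, ∀ v : V, act (srefl β) v = v - coroot β v • β
  act_faithful : ∀ g : W, (∀ v : V, act g v = v) → g = 1
  roots_invariant : ∀ g : W, ∀ β ∈ roots, act g β ∈ roots
  coroot_equivariant : ∀ g : W, ∀ β ∈ roots, ∀ v : V,
    coroot (act g β) (act g v) = coroot β v
  generated : ∀ g : W, ∃ l : List I, g = (l.map fun i => srefl (simple i)).prod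

namespace WeylSetting

attribute [instance] fintypeI decEqI acg mod grp

variable (D : WeylSetting)

/-- the simple reflection attached to a node of the Dynkin diagram -/
def s (i : D.I) : D.W := D.srefl (D.simple i)

/-- the product `s_{i_1} ⋯ s_{i_r}` of the simple reflections listed in `l` -/
def wordProd (l : List D.I) : D.W := (l.map D.s).prod

/-- `β` is a positive root: a root which is a nonnegative combination of simple roots -/
def IsPosRoot (β : D.V) : Prop :=
  β ∈ D.roots ∧ ∃ c : D.I → ℚ, (∀ i, 0 ≤ c i) ∧ β = ∑ i, c i • D.simple i

/-- the length of a Weyl group element -/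
noncomputable def length (g : D.W) : ℕ :=
  sInf {n | ∃ l : List D.I, l.length = n ∧ D.wordProd l = g}

/-- `l` is a reduced word for `g` -/
def IsReduced (l : List D.I) (g : D.W) : Prop :=
  D.wordProd l = g ∧ l.length = D.length g

/-- the number of reduced words of `g` -/
noncomputable def RedCard (g : D.W) : ℕ := Nat.card {l : List D.I // D.IsReduced l g}

/-- the (strong) Bruhat order on the Weyl group -/
def bruhatLE : D.W → D.W → Prop :=
  Relation.ReflTransGen
    (fun a b => (∃ β, D.IsPosRoot β ∧ b = D.srefl β * a) ∧ D.length a < D.length b)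

/-- strict (strong) Bruhat order -/
def bruhatLT (a b : D.W) : Prop := D.bruhatLE a b ∧ a ≠ b

/-- the left weak Bruhat order: `a ≤_L b` iff `ℓ(b a⁻¹) + ℓ(a) = ℓ(b)` -/
def weakLE (a b : D.W) : Prop := D.length (b * a⁻¹) + D.length a = D.length b

/-- the height of a positive root: the sum of its coefficients in the simple roots -/
noncomputable def ht (β : D.V) : ℕ := ∑ i, D.posCoeff β i

/-- an integral weight: the pairings with all positive coroots are integers -/
def IsIntegral (lam : D.V) : Prop :=
  ∀ β, D.IsPosRoot β → ∃ n : ℤ, D.coroot β lam = n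

/-- a dominant integral weight -/
def IsDominant (lam : D.V) : Prop :=
  D.IsIntegral lam ∧ ∀ i, 0 ≤ D.coroot (D.simple i) lam

/-- a pre-dominant integral weight: `⟨λ, β∨⟩ ≥ -1` for all positive roots `β` -/
def IsPreDominant (lam : D.V) : Prop :=
  D.IsIntegral lam ∧ ∀ β, D.IsPosRoot β → -1 ≤ D.coroot β lam

/-- the diagram `D(λ) = {β ∈ R⁺ : ⟨λ, β∨⟩ = -1}` of a pre-dominant weight -/
noncomputable def diagram (lam : D.V) : Finset D.V :=
  D.roots.filter fun β => D.IsPosRoot β ∧ D.coroot β lam = -1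

/-- `IsWeightPath λ [β₁, …, β_r]` says that
`λ = λ₀ →β₁ λ₁ →β₂ ⋯ →β_r λ_r` is a `λ`-path, i.e. each `β_j` is a positive
root, `⟨λ_{j-1}, β_j∨⟩ = -1` and `λ_j = s_{β_j}(λ_{j-1})`. -/
def IsWeightPath : D.V → List D.V → Prop
  | _, [] => True
  | lam, β :: rest =>
      D.IsPosRoot β ∧ D.coroot β lam = -1 ∧
        IsWeightPath (D.act (D.srefl β) lam) rest

/-- the term `1/β₁ ⋅ 1/(β₁+β₂) ⋅ … ⋅ 1/(β₁+⋯+β_r)` attached to a path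
`(β₁, …, β_r)`, computed in a field `F` via a linear embedding `emb`. -/
noncomputable def pathTerm {F : Type} [Field F] [Algebra ℚ F]
    (emb : D.V →ₗ[ℚ] F) (l : List D.V) : F :=
  ∏ j ∈ Finset.range l.length, (emb ((l.take (j + 1)).sum))⁻¹

/-- `w` is a π-minuscule element (in the sense of Peterson). -/
def IsMinuscule (pi : D.V) (w : D.W) : Prop :=
  ∃ l : List D.I, D.IsReduced l w ∧
    ∀ k : Fin l.length,
      D.coroot (D.simple (l.get k)) (D.act (D.wordProd (l.drop (k.val + 1))) pi) = 1

/-- the stabilizer `W_π = Stab_W(π)` of a weight -/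
def stab (pi : D.V) : Subgroup D.W where
  carrier := {g | D.act g pi = pi}
  one_mem' := by simp
  mul_mem' := by
    intro a b ha hb
    simp only [Set.mem_setOf_eq] at *
    calc D.act (a * b) pi = D.act a (D.act b pi) := by rw [map_mul]; rfl
    _ = pi := by rw [hb, ha]
  inv_mem' := by
    intro a ha
    simp only [Set.mem_setOf_eq] at *
    calc D.act a⁻¹ pi = D.act a⁻¹ (D.act a pi) := by rw [ha]
    _ = D.act (a⁻¹ * a) pi := by rw [map_mul]; rfl
    _ = pi := by simp

/-- `u` is the minimal-length representative of its coset `uH` -/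
def IsMinRep (H : Subgroup D.W) (u : D.W) : Prop :=
  ∀ g : D.W, u⁻¹ * g ∈ H → D.length u ≤ D.length g

/-- `a` and `b` lie in the same coset of `H`, i.e. `aH = bH` -/
def SameCoset (H : Subgroup D.W) (a b : D.W) : Prop := a⁻¹ * b ∈ H

/-- `u →β w` in `W^P`: `β` is a positive root, `u, w` are minimal-length
representatives, `s_β w H = u H`, and `u < w` in Bruhat order -/
def Arrow (H : Subgroup D.W) (u w : D.W) (β : D.V) : Prop :=
  D.IsPosRoot β ∧ D.IsMinRep H u ∧ D.IsMinRep H w ∧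
    D.SameCoset H (D.srefl β * w) u ∧ D.bruhatLT u w

/-- `ArrowPath H w [β₁, …, β_r]` encodes a directed path
`x_r →β_r ⋯ → x_1 →β₁ x_0 = w` in the Bruhat graph on `W^P`. -/
def ArrowPath (H : Subgroup D.W) : D.W → List D.V → Prop
  | _, [] => True
  | w, β :: rest => ∃ u, D.Arrow H u w β ∧ ArrowPath H u rest

/-- directed paths as above whose vertices all lie above `v` in Bruhat order -/
def ArrowPathGE (H : Subgroup D.W) (v : D.W) : D.W → List D.V → Prop
  | _, [] => True
  | w, β :: rest => ∃ u, D.Arrow H u w β ∧ D.bruhatLE v u ∧ ArrowPathGE H v u rest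

/-- directed paths from `u` to `w`:
`u = x_r →β_r ⋯ → x_1 →β₁ x_0 = w` encoded by the list `[β₁, …, β_r]`. -/
def ArrowPathFromTo (H : Subgroup D.W) (u : D.W) : D.W → List D.V → Prop
  | w, [] => u = w
  | w, β :: rest => ∃ x, D.Arrow H x w β ∧ ArrowPathFromTo H u x rest

/-- `S(w) = {β ∈ R⁺ : s_β w < w}` -/
noncomputable def Sset (w : D.W) : Finset D.V :=
  D.roots.filter fun β => D.IsPosRoot β ∧ D.bruhatLT (D.srefl β * w) w

/-- `S(w/v) = {β ∈ R⁺ : v ≤ s_β w < w}` -/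
noncomputable def SsetSkew (v w : D.W) : Finset D.V :=
  D.roots.filter fun β =>
    D.IsPosRoot β ∧ D.bruhatLE v (D.srefl β * w) ∧ D.bruhatLT (D.srefl β * w) w

/-- an oriented edge `x → y` in the Bruhat graph of `G/P`: `x, y` are minimal
representatives, `xH < yH`, and `yH = x s_γ H` for some positive root `γ` -/
def GEdge (H : Subgroup D.W) (x y : D.W) : Prop :=
  D.IsMinRep H x ∧ D.IsMinRep H y ∧ D.bruhatLT x y ∧
    ∃ γ, D.IsPosRoot γ ∧ D.SameCoset H (x * D.srefl γ) y

/-- the (unique) positive root `γ` with `yH = x s_γ H` attached to an edge -/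
noncomputable def edgeRoot (H : Subgroup D.W) (x y : D.W) : D.V :=
  if h : ∃ γ, D.IsPosRoot γ ∧ D.SameCoset H (x * D.srefl γ) y then h.choose else 0

/-- `GChainTo H v t [x₁, …, x_r]` encodes a directed path
`v ≤ x_r → ⋯ → x_1 → x_0 = t` in the Bruhat graph of `G/P` -/
def GChainTo (H : Subgroup D.W) (v : D.W) : D.W → List D.W → Prop
  | _, [] => True
  | t, x :: rest => D.GEdge H x t ∧ D.bruhatLE v x ∧ GChainTo H v x rest

/-- the weighted term
`(m_Λ(x_r,x_{r-1})/W_Λ(x_r)) ⋯ (m_Λ(x_1,x_0)/W_Λ(x_1))` of a path in the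
`Λ`-Bruhat graph, computed in a field `F` via a linear embedding `emb`. -/
noncomputable def chainTerm {F : Type} [Field F] [Algebra ℚ F]
    (emb : D.V →ₗ[ℚ] F) (H : Subgroup D.W) (Lam : D.W → D.V) (w : D.W) :
    D.W → List D.W → F
  | _, [] => 1
  | t, x :: rest =>
      algebraMap ℚ F (D.coroot (D.edgeRoot H x t) (Lam x)) *
        (emb (D.act x (Lam x) - D.act w (Lam x)))⁻¹ *
        chainTerm emb H Lam w x rest

/-- the Bruhat order on cosets: `aH ≤ bH` -/
def cosetLE (H : Subgroup D.W) (a b : D.W) : Prop :=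
  ∃ x y, D.SameCoset H a x ∧ D.SameCoset H b y ∧ D.bruhatLE x y

/-- the (standard) parabolic subgroup generated by simple reflections in `J` -/
def parab (J : Set D.I) : Subgroup D.W := Subgroup.closure (D.s '' J)

/-- `X*(T)_P`: integral weights orthogonal to all coroots of `W_P`,
i.e. to `γ∨` for all positive roots `γ` in the span of the simple roots of `P` -/
def OrthWeightP (J : Set D.I) (lam : D.V) : Prop :=
  D.IsIntegral lam ∧
    ∀ γ, D.IsPosRoot γ → γ ∈ Submodule.span ℚ (D.simple '' J) → D.coroot γ lam = 0

/-- an admissible function `Λ : [v,w]^P → X*(T)_P` -/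
def Admissible (J : Set D.I) (v w : D.W) (Lam : D.W → D.V) : Prop :=
  (∀ x, D.IsMinRep (D.parab J) x → D.bruhatLE v x → D.bruhatLE x w →
      D.OrthWeightP J (Lam x)) ∧
  (∀ x, D.IsMinRep (D.parab J) x → D.bruhatLE v x → D.bruhatLE x w → x ≠ w →
      D.act x (Lam x) ≠ D.act w (Lam x))

/-- the subword of `l` with letters at the positions in `S`, in increasing order -/
def subwordF (l : List D.I) (S : Finset (Fin l.length)) : List D.I :=
  ((List.finRange l.length).filter fun j => j ∈ S).map l.get

/-- `β_j = s_{i_1} ⋯ s_{i_{j-1}}(α_{i_j})` attached to a reduced word `l` -/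
noncomputable def refRoot (l : List D.I) (j : Fin l.length) : D.V :=
  D.act (D.wordProd (l.take j.val)) (D.simple (l.get j))

/-- the Weyl group is simply laced: the Cartan pairing is symmetric -/
def SimplyLaced : Prop :=
  ∀ i j, D.coroot (D.simple i) (D.simple j) = D.coroot (D.simple j) (D.simple i)

/-- generating relation of the heap order of the word `l`:
`p_j < p_k` whenever `j < k` and `s_{i_j}`, `s_{i_k}` do not commute -/
def heapCovers (l : List D.I) (j k : Fin l.length) : Prop :=
  (j : ℕ) < (k : ℕ) ∧ D.s (l.get j) * D.s (l.get k) ≠ D.s (l.get k) * D.s (l.get j)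

/-- the heap order of the word `l`: the minimal partial order generated by
`heapCovers` -/
def heapLE (l : List D.I) : Fin l.length → Fin l.length → Prop :=
  Relation.ReflTransGen (D.heapCovers l)

/-- strict heap order -/
def heapLT (l : List D.I) (j k : Fin l.length) : Prop := D.heapLE l j k ∧ j ≠ k

/-- `F` is an order filter of the heap `H(w)` of the word `l` -/
def IsHeapFilter (l : List D.I) (F : Finset (Fin l.length)) : Prop :=
  ∀ j k, j ∈ F → D.heapLE l j k → k ∈ F

/-- `i` and `j` are joined by an edge of the Dynkin diagram -/
def adjDynkin (i j : D.I) : Prop := i ≠ j ∧ D.s i * D.s j ≠ D.s j * D.s i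

/-- an elementary excitation `A ▷ B` of subsets of the heap of the word `l` -/
def Excite (l : List D.I) (A B : Finset (Fin l.length)) : Prop :=
  ∃ p q, D.heapLT l p q ∧ l.get p = l.get q ∧ q ∈ A ∧ p ∈ B ∧
    A.erase q = B.erase p ∧
    (∀ z, D.heapLT l p z → D.heapLT l z q → l.get z ≠ l.get p) ∧
    ∀ u ∈ A, D.heapLE l p u → D.heapLE l u q → ¬ D.adjDynkin (l.get p) (l.get u)

/-- `A` is an excited diagram of `F` in the heap of the word `l`,
i.e. `A ∈ E_{H(w)}(F)` -/
def InExcited (l : List D.I) (F A : Finset (Fin l.length)) : Prop :=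
  Relation.ReflTransGen (D.Excite l) F A

end WeylSetting

namespace WeylSetting

variable (D : WeylSetting)

/-! ### Basic facts about the action -/

theorem exists_functional (φ : D.I → ℚ) :
    ∃ h : D.V →ₗ[ℚ] ℚ, ∀ i, h (D.simple i) = φ i := by
  have hli := D.simple_indep
  obtain ⟨h, hh⟩ := LinearMap.exists_extend ((Module.Basis.span hli).constr ℚ φ)
  refine ⟨h, fun i => ?_⟩
  have h1 := (Module.Basis.span hli).constr_basis ℚ φ i
  rw [← hh] at h1
  simpa [Module.Basis.span_apply] using h1

/-- a coordinate functional for the simple roots -/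
noncomputable def co (i : D.I) : D.V →ₗ[ℚ] ℚ :=
  (D.exists_functional (fun j => if j = i then 1 else 0)).choose

theorem co_simple (i j : D.I) : D.co i (D.simple j) = if j = i then 1 else 0 :=
  (D.exists_functional (fun j => if j = i then 1 else 0)).choose_spec j

/-- the height functional -/
noncomputable def hf : D.V →ₗ[ℚ] ℚ := (D.exists_functional (fun _ => 1)).choose

theorem hf_simple (i : D.I) : D.hf (D.simple i) = 1 :=
  (D.exists_functional (fun _ => 1)).choose_spec i

theorem act_mul (g k : D.W) (x : D.V) : D.act (g * k) x = D.act g (D.act k x) := by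
  rw [map_mul]; rfl

theorem act_one (x : D.V) : D.act 1 x = x := by simp

theorem act_inv_act (g : D.W) (x : D.V) : D.act g⁻¹ (D.act g x) = x := by
  rw [← act_mul]; simp

theorem act_act_inv (g : D.W) (x : D.V) : D.act g (D.act g⁻¹ x) = x := by
  rw [← act_mul]; simp

theorem faith {g k : D.W} (h : ∀ x, D.act g x = D.act k x) : g = k := by
  have : k⁻¹ * g = 1 := D.act_faithful _ fun x => by
    rw [act_mul, h, act_inv_act]
  rw [inv_mul_eq_one] at this
  exact this.symm

theorem root_ne_zero {β : D.V} (hβ : β ∈ D.roots) : β ≠ 0 := by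
  rintro rfl
  have := D.coroot_self 0 hβ
  simp at this

theorem pos_or_neg {β : D.V} (hβ : β ∈ D.roots) : D.IsPosRoot β ∨ D.IsPosRoot (-β) := by
  rcases D.root_pos_or_neg β hβ with h | h
  · exact Or.inl ⟨hβ, h⟩
  · exact Or.inr ⟨D.roots_neg β hβ, h⟩

theorem co_sum (c : D.I → ℚ) (i : D.I) : D.co i (∑ j, c j • D.simple j) = c i := by
  simp [co_simple]

theorem co_nonneg {β : D.V} (hβ : D.IsPosRoot β) (i : D.I) : 0 ≤ D.co i β := by
  obtain ⟨_, c, hc, rfl⟩ := hβ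
  rw [co_sum]; exact hc i

theorem pos_expand {β : D.V} (hβ : D.IsPosRoot β) : β = ∑ i, D.co i β • D.simple i := by
  obtain ⟨_, c, hc, rfl⟩ := hβ
  simp only [co_sum]

theorem co_eq_posCoeff {β : D.V} (hβ : D.IsPosRoot β) (i : D.I) :
    D.co i β = D.posCoeff β i := by
  have h := D.posCoeff_spec β hβ.1 hβ.2
  have := congrArg (D.co i) h
  rwa [co_sum] at this

theorem hf_eq_ht {β : D.V} (hβ : D.IsPosRoot β) : D.hf β = D.ht β := by
  have h := D.posCoeff_spec β hβ.1 hβ.2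
  have := congrArg D.hf h
  rw [this]
  simp [hf_simple, ht]

theorem not_pos_neg {β : D.V} (hβ : D.IsPosRoot β) : ¬ D.IsPosRoot (-β) := by
  intro hn
  apply D.root_ne_zero hβ.1
  rw [D.pos_expand hβ]
  apply Finset.sum_eq_zero
  intro i _
  have h1 := D.co_nonneg hβ i
  have h2 := D.co_nonneg hn i
  rw [map_neg] at h2
  have : D.co i β = 0 := by linarith
  rw [this, zero_smul]

theorem hf_pos {β : D.V} (hβ : D.IsPosRoot β) : 0 < D.hf β := by
  have h : D.hf β = ∑ i, D.co i β := by
    conv_lhs => rw [D.pos_expand hβ]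
    simp [hf_simple]
  rw [h]
  have h0 : 0 ≤ ∑ i, D.co i β := Finset.sum_nonneg fun i _ => D.co_nonneg hβ i
  refine lt_of_le_of_ne h0 fun h1 => ?_
  have h2 := (Finset.sum_eq_zero_iff_of_nonneg fun i _ => D.co_nonneg hβ i).1 h1.symm
  apply D.root_ne_zero hβ.1
  rw [D.pos_expand hβ]
  apply Finset.sum_eq_zero
  intro i hi
  rw [h2 i hi, zero_smul]

theorem simple_pos (i : D.I) : D.IsPosRoot (D.simple i) := by
  refine ⟨D.simple_mem i, fun j => if j = i then 1 else 0, fun j => by positivity, by simp⟩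

theorem s_act (i : D.I) (x : D.V) :
    D.act (D.s i) x = x - D.coroot (D.simple i) x • D.simple i :=
  D.srefl_apply _ (D.simple_mem i) x

/-! ### The invariant form -/

/-- an invariant symmetric form -/
noncomputable def bil (x y : D.V) : ℚ := ∑ γ ∈ D.roots, D.coroot γ x * D.coroot γ y

theorem bil_act (g : D.W) (x y : D.V) : D.bil (D.act g x) (D.act g y) = D.bil x y := by
  unfold bil
  symm
  refine Finset.sum_bij' (fun γ _ => D.act g γ) (fun γ _ => D.act g⁻¹ γ) ?_ ?_ ?_ ?_ ?_
  · intro γ hγ; exact D.roots_invariant g γ hγ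
  · intro γ hγ; exact D.roots_invariant _ γ hγ
  · intro γ _; exact D.act_inv_act g γ
  · intro γ _; exact D.act_act_inv g γ
  · intro γ hγ
    rw [D.coroot_equivariant g γ hγ, D.coroot_equivariant g γ hγ]

theorem bil_self_pos {β : D.V} (hβ : β ∈ D.roots) : 0 < D.bil β β := by
  unfold bil
  apply Finset.sum_pos' (fun γ _ => mul_self_nonneg _)
  exact ⟨β, hβ, by rw [D.coroot_self β hβ]; norm_num⟩

theorem bil_smul_right (c : ℚ) (x y : D.V) : D.bil x (c • y) = c * D.bil x y := by
  unfold bil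
  rw [Finset.mul_sum]
  refine Finset.sum_congr rfl fun γ _ => ?_
  rw [map_smul, smul_eq_mul]; ring

theorem bil_smul_left (c : ℚ) (x y : D.V) : D.bil (c • x) y = c * D.bil x y := by
  unfold bil
  rw [Finset.mul_sum]
  refine Finset.sum_congr rfl fun γ _ => ?_
  rw [map_smul, smul_eq_mul]; ring

theorem bil_sub_left (x y z : D.V) : D.bil (x - y) z = D.bil x z - D.bil y z := by
  unfold bil
  rw [← Finset.sum_sub_distrib]
  refine Finset.sum_congr rfl fun γ _ => ?_
  rw [map_sub]; ring

theorem bil_sum_right {ι : Type} (t : Finset ι) (x : D.V) (y : ι → D.V) :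
    D.bil x (∑ i ∈ t, y i) = ∑ i ∈ t, D.bil x (y i) := by
  unfold bil
  rw [Finset.sum_comm]
  refine Finset.sum_congr rfl fun γ _ => ?_
  rw [map_sum, Finset.mul_sum]

theorem bil_comm (x y : D.V) : D.bil x y = D.bil y x := by
  unfold bil
  exact Finset.sum_congr rfl fun γ _ => mul_comm _ _

theorem coroot_bil {β : D.V} (hβ : β ∈ D.roots) (x : D.V) :
    D.coroot β x * D.bil β β = 2 * D.bil x β := by
  have h := D.bil_act (D.srefl β) x β
  rw [D.srefl_apply β hβ, D.srefl_apply β hβ, D.coroot_self β hβ] at h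
  have h2 : β - (2 : ℚ) • β = (-1 : ℚ) • β := by module
  rw [h2, bil_smul_right, bil_sub_left, bil_smul_left] at h
  linarith

theorem coroot_smul {β : D.V} {c : ℚ} (hc : c ≠ 0) (hβ : β ∈ D.roots) (hcβ : c • β ∈ D.roots)
    (x : D.V) : c * D.coroot (c • β) x = D.coroot β x := by
  have h1 := D.coroot_bil hβ x
  have h2 := D.coroot_bil hcβ x
  rw [bil_smul_right, bil_smul_right, bil_smul_left] at h2
  have h3 := D.bil_self_pos hβ
  have h4 : c * (c * D.coroot (c • β) x * D.bil β β) = c * (D.coroot β x * D.bil β β) := by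
    rw [h1]; linarith
  exact mul_right_cancel₀ h3.ne' (mul_left_cancel₀ hc h4)

theorem coroot_neg {β : D.V} (hβ : β ∈ D.roots) (x : D.V) :
    D.coroot (-β) x = - D.coroot β x := by
  have h : (-1 : ℚ) • β = -β := by module
  have := D.coroot_smul (c := -1) (by norm_num) hβ (by rw [h]; exact D.roots_neg β hβ) x
  rw [h] at this
  linarith

theorem srefl_smul {β : D.V} {c : ℚ} (hc : c ≠ 0) (hβ : β ∈ D.roots) (hcβ : c • β ∈ D.roots) :
    D.srefl (c • β) = D.srefl β := by
  apply D.faith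
  intro x
  rw [D.srefl_apply _ hcβ, D.srefl_apply _ hβ, ← D.coroot_smul hc hβ hcβ x, smul_smul, mul_comm]

theorem dominant_nonneg {pi β : D.V} (hpi : D.IsDominant pi) (hβ : D.IsPosRoot β) :
    0 ≤ D.coroot β pi := by
  have h1 := D.coroot_bil hβ.1 pi
  have h2 := D.bil_self_pos hβ.1
  have h3 : 0 ≤ D.bil pi β := by
    rw [D.pos_expand hβ, bil_sum_right]
    apply Finset.sum_nonneg
    intro i _
    rw [bil_smul_right]
    apply mul_nonneg (D.co_nonneg hβ i)
    have h4 := D.coroot_bil (D.simple_mem i) pi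
    have h5 := mul_nonneg (hpi.2 i) (D.bil_self_pos (D.simple_mem i)).le
    linarith
  by_contra hlt
  push Not at hlt
  nlinarith

theorem integral_root {pi β : D.V} (hpi : D.IsIntegral pi) (hβ : β ∈ D.roots) :
    ∃ n : ℤ, D.coroot β pi = n := by
  rcases D.pos_or_neg hβ with h | h
  · exact hpi β h
  · obtain ⟨n, hn⟩ := hpi _ h
    rw [D.coroot_neg hβ] at hn
    exact ⟨-n, by push_cast; linarith⟩

theorem cartan_cases {i j : D.I} (hij : i ≠ j) :
    D.coroot (D.simple i) (D.simple j) = 0 ∨ D.coroot (D.simple i) (D.simple j) ≤ -1 := by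
  obtain ⟨n, hn⟩ := D.crystallographic _ (D.simple_mem i) _ (D.simple_mem j)
  have hle : D.coroot (D.simple i) (D.simple j) ≤ 0 := by
    have hr := D.roots_invariant (D.s i) _ (D.simple_mem j)
    rcases D.pos_or_neg hr with h | h
    · have := D.co_nonneg h i
      rw [s_act, map_sub, map_smul, co_simple, co_simple, if_neg hij.symm, if_pos rfl] at this
      simp at this
      exact this
    · have := D.co_nonneg h j
      rw [s_act, map_neg, map_sub, map_smul, co_simple, co_simple, if_neg hij, if_pos rfl] at this
      norm_num at this
  rw [hn] at hle ⊢
  have : n ≤ 0 := by exact_mod_cast hle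
  rcases this.lt_or_eq with h | h
  · right; have : n ≤ -1 := by omega
    exact_mod_cast this
  · left; simp [h]

theorem cartan_zero {i j : D.I} (h : D.coroot (D.simple i) (D.simple j) = 0) :
    D.coroot (D.simple j) (D.simple i) = 0 := by
  have h1 := D.coroot_bil (D.simple_mem i) (D.simple j)
  have h2 := D.coroot_bil (D.simple_mem j) (D.simple i)
  rw [h, zero_mul] at h1
  rw [D.bil_comm (D.simple i), ← h1] at h2
  exact (mul_eq_zero.1 h2).resolve_right (D.bil_self_pos (D.simple_mem j)).ne'

theorem cartan_neg {i j : D.I} (hij : i ≠ j) (h : D.coroot (D.simple i) (D.simple j) ≤ -1) :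
    D.coroot (D.simple j) (D.simple i) ≤ -1 := by
  rcases D.cartan_cases hij.symm with h1 | h1
  · have := D.cartan_zero h1
    linarith
  · exact h1

/-! ### Reflections -/

theorem coroot_act {β : D.V} (hβ : β ∈ D.roots) (g : D.W) (x : D.V) :
    D.coroot β (D.act g x) = D.coroot (D.act g⁻¹ β) x := by
  have := D.coroot_equivariant g _ (D.roots_invariant g⁻¹ β hβ) x
  rwa [act_act_inv] at this

theorem coroot_act' {β : D.V} (hβ : β ∈ D.roots) (g : D.W) (x : D.V) :
    D.coroot (D.act g β) (D.act g x) = D.coroot β x :=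
  D.coroot_equivariant g β hβ x

theorem srefl_conj {β : D.V} (hβ : β ∈ D.roots) (g : D.W) :
    D.srefl (D.act g β) = g * D.srefl β * g⁻¹ := by
  apply D.faith
  intro x
  rw [D.srefl_apply _ (D.roots_invariant g β hβ), act_mul, act_mul, D.srefl_apply _ hβ, map_sub,
    map_smul, act_act_inv]
  congr 2
  rw [← D.coroot_act' hβ g (D.act g⁻¹ x), act_act_inv]

theorem srefl_self {β : D.V} (hβ : β ∈ D.roots) : D.act (D.srefl β) β = -β := by
  rw [D.srefl_apply _ hβ, D.coroot_self _ hβ]; module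

theorem srefl_mul_self {β : D.V} (hβ : β ∈ D.roots) : D.srefl β * D.srefl β = 1 := by
  apply D.faith
  intro x
  rw [act_mul, D.srefl_apply _ hβ x, map_sub, map_smul, srefl_self _ hβ, D.srefl_apply _ hβ x,
    act_one]
  module

theorem srefl_inv {β : D.V} (hβ : β ∈ D.roots) : (D.srefl β)⁻¹ = D.srefl β :=
  inv_eq_of_mul_eq_one_right (D.srefl_mul_self hβ)

theorem srefl_srefl {β : D.V} (hβ : β ∈ D.roots) (x : D.W) :
    D.srefl β * (D.srefl β * x) = x := by
  rw [← mul_assoc, srefl_mul_self _ hβ, one_mul]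

theorem s_mul_self (i : D.I) : D.s i * D.s i = 1 := D.srefl_mul_self (D.simple_mem i)

theorem s_s (i : D.I) (x : D.W) : D.s i * (D.s i * x) = x := D.srefl_srefl (D.simple_mem i) x

theorem s_inv (i : D.I) : (D.s i)⁻¹ = D.s i := D.srefl_inv (D.simple_mem i)

theorem s_act_s (i : D.I) (x : D.V) : D.act (D.s i) (D.act (D.s i) x) = x := by
  rw [← act_mul, s_mul_self, act_one]

theorem s_comm {i j : D.I} (h : D.coroot (D.simple i) (D.simple j) = 0) :
    D.s i * D.s j = D.s j * D.s i := by
  apply D.faith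
  intro x
  simp only [act_mul, s_act, map_sub, map_smul, h, D.cartan_zero h]
  module

theorem simple_step {β : D.V} {i : D.I} (hβ : D.IsPosRoot β)
    (hn : D.IsPosRoot (-D.act (D.s i) β)) : ∃ c : ℚ, 0 < c ∧ β = c • D.simple i := by
  have hk : ∀ k, k ≠ i → D.co k β = 0 := by
    intro k hk
    have h1 := D.co_nonneg hβ k
    have h2 := D.co_nonneg hn k
    rw [s_act, map_neg, map_sub, map_smul, co_simple, if_neg hk.symm] at h2
    simp at h2
    linarith
  have he : β = D.co i β • D.simple i := by
    conv_lhs => rw [D.pos_expand hβ]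
    rw [Finset.sum_eq_single i]
    · intro k _ h; rw [hk k h, zero_smul]
    · simp
  refine ⟨D.co i β, lt_of_le_of_ne (D.co_nonneg hβ i) ?_, he⟩
  intro h0
  rw [← h0, zero_smul] at he
  exact D.root_ne_zero hβ.1 he

theorem one_le_of_smul {c : ℚ} {i : D.I} (hc : 0 < c) (h : D.IsPosRoot (c • D.simple i)) :
    1 ≤ c := by
  have h1 := D.co_eq_posCoeff h i
  rw [map_smul, co_simple, if_pos rfl, smul_eq_mul, mul_one] at h1
  rw [h1] at hc ⊢
  have : 0 < D.posCoeff (c • D.simple i) i := by exact_mod_cast hc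
  exact_mod_cast this

theorem act_neg_root {β : D.V} (g : D.W) (hβ : β ∈ D.roots) (h : ¬ D.IsPosRoot (D.act g β)) :
    D.IsPosRoot (-D.act g β) :=
  (D.pos_or_neg (D.roots_invariant g β hβ)).resolve_left h

/-! ### Words, exchange, length -/

theorem wP_nil : D.wordProd [] = 1 := rfl

theorem wP_cons (i : D.I) (l : List D.I) : D.wordProd (i :: l) = D.s i * D.wordProd l := by
  simp [wordProd]

theorem wP_append (l m : List D.I) : D.wordProd (l ++ m) = D.wordProd l * D.wordProd m := by
  simp [wordProd]

theorem exists_word (g : D.W) : ∃ l, D.wordProd l = g := by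
  obtain ⟨l, hl⟩ := D.generated g
  exact ⟨l, hl.symm⟩

theorem exchange (l : List D.I) : ∀ β : D.V, D.IsPosRoot β →
    D.IsPosRoot (-D.act (D.wordProd l)⁻¹ β) →
    ∃ A i B, ∃ c : ℚ, l = A ++ i :: B ∧ 0 < c ∧ β = c • D.act (D.wordProd A) (D.simple i) := by
  induction l with
  | nil =>
    intro β h1 h2
    rw [wP_nil, inv_one, act_one] at h2
    exact absurd h2 (D.not_pos_neg h1)
  | cons i l ih =>
    intro β h1 h2
    rw [wP_cons, mul_inv_rev, act_mul, s_inv] at h2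
    by_cases h : D.IsPosRoot (D.act (D.s i) β)
    · obtain ⟨A, j, B, c, rfl, hc, he⟩ := ih _ h h2
      refine ⟨i :: A, j, B, c, rfl, hc, ?_⟩
      rw [wP_cons, act_mul, ← map_smul, ← he, s_act_s]
    · obtain ⟨c, hc, he⟩ := D.simple_step h1 (D.act_neg_root _ h1.1 h)
      exact ⟨[], i, l, c, rfl, hc, by rw [wP_nil, act_one, he]⟩

theorem srefl_del (A B : List D.I) (i : D.I) :
    D.srefl (D.act (D.wordProd A) (D.simple i)) * D.wordProd (A ++ i :: B) =
      D.wordProd (A ++ B) := by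
  rw [D.srefl_conj (D.simple_mem i), wP_append, wP_append, wP_cons]
  change D.wordProd A * D.s i * _ * _ = _
  have := D.s_s i (D.wordProd B)
  calc _ = D.wordProd A * (D.s i * (D.s i * D.wordProd B)) := by group
    _ = _ := by rw [this]

theorem exchange_del {l A B : List D.I} {i : D.I} {c : ℚ} {β : D.V} (hβ : D.IsPosRoot β)
    (hl : l = A ++ i :: B) (hc : 0 < c)
    (he : β = c • D.act (D.wordProd A) (D.simple i)) :
    D.srefl β * D.wordProd l = D.wordProd (A ++ B) := by
  have hr := D.roots_invariant (D.wordProd A) _ (D.simple_mem i)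
  have : D.srefl β = D.srefl (D.act (D.wordProd A) (D.simple i)) := by
    rw [he]
    exact D.srefl_smul hc.ne' hr (he ▸ hβ.1)
  rw [this, hl, srefl_del]

theorem length_le (l : List D.I) : D.length (D.wordProd l) ≤ l.length :=
  Nat.sInf_le ⟨l, rfl, rfl⟩

theorem exists_reduced (g : D.W) : ∃ l, D.wordProd l = g ∧ l.length = D.length g := by
  obtain ⟨l, hl⟩ := D.exists_word g
  have := Nat.sInf_mem (s := {n | ∃ l : List D.I, l.length = n ∧ D.wordProd l = g})
    ⟨_, l, rfl, hl⟩
  obtain ⟨m, h1, h2⟩ := this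
  exact ⟨m, h2, h1⟩

theorem length_lt {β : D.V} {x : D.W} (hβ : D.IsPosRoot β)
    (h : D.IsPosRoot (-D.act x⁻¹ β)) : D.length (D.srefl β * x) < D.length x := by
  obtain ⟨l, rfl, hl⟩ := D.exists_reduced x
  obtain ⟨A, i, B, c, h1, hc, he⟩ := D.exchange l β hβ h
  rw [D.exchange_del hβ h1 hc he, ← hl]
  have := D.length_le (A ++ B)
  rw [h1]
  simp at this ⊢
  omega

theorem lt_length {β : D.V} {x : D.W} (hβ : D.IsPosRoot β)
    (h : D.IsPosRoot (D.act x⁻¹ β)) : D.length x < D.length (D.srefl β * x) := by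
  have := D.length_lt (x := D.srefl β * x) hβ (by
    rw [mul_inv_rev, D.srefl_inv hβ.1, act_mul, srefl_self _ hβ.1, map_neg, neg_neg]; exact h)
  rwa [D.srefl_srefl hβ.1] at this

theorem neg_of_lt {β : D.V} {x : D.W} (hβ : D.IsPosRoot β)
    (h : D.length (D.srefl β * x) < D.length x) : D.IsPosRoot (-D.act x⁻¹ β) := by
  apply D.act_neg_root _ hβ.1
  intro h1
  have := D.lt_length hβ h1
  omega

theorem length_s_mul_le (i : D.I) (x : D.W) : D.length (D.s i * x) ≤ D.length x + 1 := by
  obtain ⟨l, rfl, hl⟩ := D.exists_reduced x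
  have := D.length_le (i :: l)
  rw [wP_cons] at this
  simpa [hl] using this

/-- a word is reduced -/
def Rd (l : List D.I) : Prop := l.length = D.length (D.wordProd l)

theorem rd_right {l m : List D.I} (h : D.Rd (l ++ m)) : D.Rd m := by
  unfold Rd at *
  obtain ⟨m', h1, h2⟩ := D.exists_reduced (D.wordProd m)
  have h3 := D.length_le (l ++ m')
  have h4 := D.length_le m
  rw [wP_append, h1, ← wP_append, ← h] at h3
  simp at h3
  omega

theorem rd_left {l m : List D.I} (h : D.Rd (l ++ m)) : D.Rd l := by
  unfold Rd at *
  obtain ⟨m', h1, h2⟩ := D.exists_reduced (D.wordProd l)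
  have h3 := D.length_le (m' ++ m)
  have h4 := D.length_le l
  rw [wP_append, h1, ← wP_append, ← h] at h3
  simp at h3
  omega

theorem rd_tail {i : D.I} {l : List D.I} (h : D.Rd (i :: l)) : D.Rd l :=
  D.rd_right (l := [i]) h

theorem rd_cons_pos {i : D.I} {l : List D.I} (h : D.Rd (i :: l)) :
    D.IsPosRoot (D.act (D.wordProd l)⁻¹ (D.simple i)) := by
  by_contra hn
  have h1 := D.length_lt (D.simple_pos i) (D.act_neg_root _ (D.simple_mem i) hn)
  have h2 := D.rd_tail h
  unfold Rd at h h2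
  rw [wP_cons] at h
  change D.length (D.s i * _) < _ at h1
  simp at h
  omega

theorem rd_cons {i : D.I} {l : List D.I} (h : D.Rd l)
    (hp : D.IsPosRoot (D.act (D.wordProd l)⁻¹ (D.simple i))) : D.Rd (i :: l) := by
  have h1 := D.lt_length (D.simple_pos i) hp
  have h2 := D.length_le (i :: l)
  unfold Rd at *
  rw [wP_cons] at *
  change _ < D.length (D.s i * _) at h1
  simp at *
  omega

theorem exists_rd_sublist (l : List D.I) :
    ∃ m, m.Sublist l ∧ D.wordProd m = D.wordProd l ∧ D.Rd m := by
  induction l with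
  | nil => exact ⟨[], List.Sublist.refl _, rfl, by
      have := D.length_le []
      unfold Rd; simp at this ⊢; omega⟩
  | cons i l ih =>
    obtain ⟨m, h1, h2, h3⟩ := ih
    by_cases hp : D.IsPosRoot (D.act (D.wordProd m)⁻¹ (D.simple i))
    · exact ⟨i :: m, h1.cons_cons i, by rw [wP_cons, wP_cons, h2], D.rd_cons h3 hp⟩
    · obtain ⟨A, j, B, c, e1, hc, he⟩ :=
        D.exchange m _ (D.simple_pos i) (D.act_neg_root _ (D.simple_mem i) hp)
      have h4 := D.exchange_del (D.simple_pos i) e1 hc he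
      change D.s i * _ = _ at h4
      refine ⟨A ++ B, ?_, ?_, ?_⟩
      · refine List.Sublist.trans ?_ (h1.trans (List.sublist_cons_self i l))
        rw [e1]; exact (List.sublist_cons_self j B).append_left A
      · rw [← h4, wP_cons, h2]
      · have h5 := D.length_s_mul_le i (D.s i * D.wordProd m)
        rw [s_s, h4] at h5
        have h6 := D.length_le (A ++ B)
        unfold Rd at *
        rw [e1] at h3 h5
        simp at *
        omega

/-! ### Bruhat order -/

theorem bruhat_step {β : D.V} {x : D.W} (hβ : D.IsPosRoot β)
    (h : D.length (D.srefl β * x) < D.length x) : D.bruhatLE (D.srefl β * x) x :=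
  Relation.ReflTransGen.single ⟨⟨β, hβ, (D.srefl_srefl hβ.1 x).symm⟩, h⟩

theorem bruhat_length {a b : D.W} (h : D.bruhatLE a b) : a = b ∨ D.length a < D.length b := by
  induction h with
  | refl => exact Or.inl rfl
  | tail _ h2 ih =>
    right
    rcases ih with rfl | ih
    · exact h2.2
    · exact ih.trans h2.2

theorem bruhat_subword {v : D.W} {l : List D.I} (h : D.bruhatLE v (D.wordProd l)) :
    ∃ m, m.Sublist l ∧ D.wordProd m = v ∧ D.Rd m := by
  suffices h' : ∃ m, m.Sublist l ∧ D.wordProd m = v by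
    obtain ⟨m, h1, h2⟩ := h'
    obtain ⟨m', h3, h4, h5⟩ := D.exists_rd_sublist m
    exact ⟨m', h3.trans h1, h4.trans h2, h5⟩
  unfold bruhatLE at h
  induction h using Relation.ReflTransGen.head_induction_on with
  | refl => exact ⟨l, List.Sublist.refl _, rfl⟩
  | head hac hcb ih =>
    rename_i a c
    obtain ⟨m, h1, h2⟩ := ih
    obtain ⟨⟨β, hβ, hb⟩, hlt⟩ := hac
    have ha : a = D.srefl β * D.wordProd m := by rw [h2, hb, D.srefl_srefl hβ.1]
    rw [← h2, ha] at hlt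
    obtain ⟨A, j, B, e, e1, hc, he⟩ := D.exchange m _ hβ (D.neg_of_lt hβ hlt)
    refine ⟨A ++ B, ?_, ?_⟩
    · refine List.Sublist.trans ?_ h1
      rw [e1]; exact (List.sublist_cons_self j B).append_left A
    · rw [ha, D.exchange_del hβ e1 hc he]

theorem bruhat_weak (p m : List D.I) (h : D.Rd (p ++ m)) :
    D.bruhatLE (D.wordProd m) (D.wordProd (p ++ m)) := by
  induction p with
  | nil => exact Relation.ReflTransGen.refl
  | cons i p ih =>
    have h1 : D.Rd (p ++ m) := D.rd_tail h
    refine Relation.ReflTransGen.tail (ih h1) ⟨⟨D.simple i, D.simple_pos i, ?_⟩, ?_⟩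
    · rw [List.cons_append, wP_cons]; rfl
    · unfold Rd at *
      rw [← h, ← h1]; simp

/-! ### Paths of weights -/

/-- `l` describes a minuscule path starting at the weight `μ` (read from the right) -/
def IsPath : List D.I → D.V → Prop
  | [], _ => True
  | i :: l, x => IsPath l x ∧ D.coroot (D.simple i) (D.act (D.wordProd l) x) = 1

theorem isPath_of_get (pi : D.V) (l : List D.I) (h : ∀ k : Fin l.length,
      D.coroot (D.simple (l.get k)) (D.act (D.wordProd (l.drop (k.val + 1))) pi) = 1) :
    D.IsPath l pi := by
  induction l with
  | nil => trivial
  | cons i l ih =>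
    refine ⟨ih fun k => ?_, ?_⟩
    · have := h k.succ
      simpa using this
    · have := h ⟨0, by simp⟩
      simpa using this

theorem minuscule_path {pi : D.V} {w : D.W} (h : D.IsMinuscule pi w) :
    ∃ l, D.Rd l ∧ D.wordProd l = w ∧ D.IsPath l pi := by
  obtain ⟨l, ⟨h1, h2⟩, h3⟩ := h
  exact ⟨l, by unfold Rd; rw [h1, h2], h1, D.isPath_of_get pi l h3⟩

theorem isPath_append (l m : List D.I) (x : D.V) :
    D.IsPath (l ++ m) x ↔ D.IsPath m x ∧ D.IsPath l (D.act (D.wordProd m) x) := by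
  induction l with
  | nil => simp [IsPath]
  | cons i l ih =>
    simp only [List.cons_append, IsPath, ih, wP_append, act_mul]
    tauto

theorem isPath_concat (l : List D.I) (j : D.I) (x : D.V) :
    D.IsPath (l ++ [j]) x ↔ D.coroot (D.simple j) x = 1 ∧ D.IsPath l (D.act (D.s j) x) := by
  rw [isPath_append]
  simp [IsPath, wordProd]

/-- the sum of the simple roots occurring in a word -/
def content (l : List D.I) : D.V := (l.map D.simple).sum

theorem path_content {l : List D.I} {x : D.V} (h : D.IsPath l x) :
    D.act (D.wordProd l) x = x - D.content l := by
  induction l with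
  | nil => simp [wordProd, content]
  | cons i l ih =>
    obtain ⟨h1, h2⟩ := h
    rw [wP_cons, act_mul, s_act, h2, ih h1]
    simp only [content, List.map_cons, List.sum_cons]
    module

theorem hf_content (l : List D.I) : D.hf (D.content l) = l.length := by
  induction l with
  | nil => simp [content]
  | cons i l ih =>
    have : D.content (i :: l) = D.simple i + D.content l := by simp [content]
    rw [this, map_add, ih, hf_simple]
    push_cast [List.length_cons]; ring

theorem hf_path {l : List D.I} {x : D.V} (h : D.IsPath l x) :
    D.hf (D.act (D.wordProd l) x) = D.hf x - l.length := by
  rw [D.path_content h, map_sub, hf_content]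

theorem pairing_s_self (i : D.I) (x : D.V) :
    D.coroot (D.simple i) (D.act (D.s i) x) = - D.coroot (D.simple i) x := by
  rw [s_act, map_sub, map_smul, D.coroot_self _ (D.simple_mem i), smul_eq_mul]; ring

/-- the key diamond lemma -/
theorem diamond (i : D.I) (l : List D.I) : ∀ x : D.V, D.IsPath (i :: l) x →
    1 ≤ D.coroot (D.simple i) x →
    D.coroot (D.simple i) x = 1 ∧ ∃ l', D.IsPath l' (D.act (D.s i) x) ∧
      D.wordProd l' * D.s i = D.s i * D.wordProd l ∧ l'.length = l.length := by
  induction l using List.reverseRecOn with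
  | nil =>
    intro x h _
    refine ⟨?_, [], trivial, by simp [wP_nil], rfl⟩
    have := h.2
    rwa [wP_nil, act_one] at this
  | append_singleton l j ih =>
    intro x h hx
    rw [← List.cons_append, isPath_concat] at h
    obtain ⟨hj, h⟩ := h
    by_cases hij : i = j
    · subst hij
      refine ⟨hj, i :: l, h, ?_, by simp⟩
      rw [wP_cons, wP_append, mul_assoc]; simp [wordProd]
    · have hs : D.coroot (D.simple i) (D.act (D.s j) x) =
          D.coroot (D.simple i) x - D.coroot (D.simple i) (D.simple j) := by
        rw [s_act, hj, one_smul, map_sub]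
      rcases D.cartan_cases hij with h0 | h0
      · rw [h0, sub_zero] at hs
        obtain ⟨e1, l', hl', e2, e3⟩ := ih _ h (by rw [hs]; exact hx)
        rw [hs] at e1
        refine ⟨e1, l' ++ [j], ?_, ?_, by simp [e3]⟩
        · rw [isPath_concat]
          constructor
          · rw [s_act, map_sub, map_smul, D.cartan_zero h0, hj]; simp
          · rw [← act_mul, ← D.s_comm h0, act_mul]; exact hl'
        · rw [wP_append, wP_append]
          have : D.wordProd [j] = D.s j := by simp [wordProd]
          rw [this, mul_assoc, ← D.s_comm h0, ← mul_assoc, e2, mul_assoc]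
      · obtain ⟨e1, -⟩ := ih _ h (by rw [hs]; linarith)
        rw [hs] at e1
        linarith

theorem path_predominant {pi : D.V} (hpi : D.IsDominant pi) (l : List D.I) :
    D.IsPath l pi → ∀ β, D.IsPosRoot β → -1 ≤ D.coroot β (D.act (D.wordProd l) pi) := by
  induction l with
  | nil =>
    intro _ β hβ
    rw [wP_nil, act_one]
    linarith [D.dominant_nonneg hpi hβ]
  | cons i l ih =>
    rintro ⟨h1, h2⟩ β hβ
    by_cases hp : D.IsPosRoot (D.act (D.s i) β)
    · rw [wP_cons, act_mul, D.coroot_act hβ.1, s_inv]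
      exact ih h1 _ hp
    · obtain ⟨c, hc, rfl⟩ := D.simple_step hβ (D.act_neg_root _ hβ.1 hp)
      have hc1 := D.one_le_of_smul hc hβ
      have h3 := D.coroot_smul hc.ne' (D.simple_mem i) hβ.1 (D.act (D.wordProd (i :: l)) pi)
      rw [wP_cons, act_mul, pairing_s_self, h2, ← act_mul, ← wP_cons] at h3
      nlinarith

theorem path_integral {pi : D.V} (hpi : D.IsDominant pi) (g : D.W) (i : D.I) :
    ∃ n : ℤ, D.coroot (D.simple i) (D.act g pi) = n := by
  rw [D.coroot_act (D.simple_mem i)]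
  exact D.integral_root hpi.1 (D.roots_invariant _ _ (D.simple_mem i))

/-! ### Inversions and minimal coset representatives -/

theorem inv_pairing {pi : D.V} (hpi : D.IsDominant pi) {l : List D.I} (hl : D.IsPath l pi)
    {γ : D.V} (hγ : D.IsPosRoot γ) (hn : D.IsPosRoot (-D.act (D.wordProd l) γ)) :
    D.coroot γ pi = 1 := by
  obtain ⟨A, i, B, c, e1, hc, he⟩ := D.exchange l _ hn (by
    rw [map_neg, act_inv_act, neg_neg]; exact hγ)
  rw [e1, isPath_append] at hl
  obtain ⟨⟨hB, h1⟩, -⟩ := hl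
  have h2 : D.act (D.wordProd B) γ = c • D.simple i := by
    rw [e1, wP_append, wP_cons, act_mul, act_mul, ← map_smul, ← map_neg] at he
    have h3 := (D.act (D.wordProd A)).injective he
    have h4 := congrArg (D.act (D.s i)) h3
    rw [map_neg, s_act_s, map_smul] at h4
    have h5 : D.act (D.s i) (D.simple i) = - D.simple i := D.srefl_self (D.simple_mem i)
    rw [h5, smul_neg] at h4
    exact neg_injective h4
  have hr : c • D.simple i ∈ D.roots := by
    rw [← h2]; exact D.roots_invariant _ _ hγ.1
  have h3 := D.coroot_smul hc.ne' (D.simple_mem i) hr (D.act (D.wordProd B) pi)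
  rw [h1, ← h2, D.coroot_act' hγ.1] at h3
  have hp : D.IsPosRoot (c • D.simple i) := by
    refine ⟨hr, fun j => if j = i then c else 0, fun j => ?_, by simp⟩
    by_cases hji : j = i
    · simp [hji, hc.le]
    · simp [hji]
  have hc1 := D.one_le_of_smul hc hp
  obtain ⟨n, hn⟩ := hpi.1 γ hγ
  rw [hn] at h3 ⊢
  have hn0 : 0 < n := by
    have : (0 : ℚ) < n := by
      by_contra hle
      push Not at hle
      nlinarith
    exact_mod_cast this
  have hn1 : (1 : ℚ) ≤ n := by exact_mod_cast hn0
  nlinarith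

/-- all inversions pair positively with `pi` -/
def MinR (pi : D.V) (x : D.W) : Prop :=
  ∀ γ, D.IsPosRoot γ → D.IsPosRoot (-D.act x γ) → 0 < D.coroot γ pi

theorem path_minR {pi : D.V} (hpi : D.IsDominant pi) {l : List D.I} (hl : D.IsPath l pi) :
    D.MinR pi (D.wordProd l) := fun γ h1 h2 => by
  rw [D.inv_pairing hpi hl h1 h2]; norm_num

theorem eq_one_of_pos {z : D.W} (h : ∀ γ, D.IsPosRoot γ → D.IsPosRoot (D.act z γ)) : z = 1 := by
  obtain ⟨l, h1, h2⟩ := D.exists_reduced z⁻¹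
  cases l with
  | nil => rw [wP_nil] at h1; rwa [eq_comm, inv_eq_one] at h1
  | cons i l =>
    exfalso
    have h3 : D.Rd (i :: l) := by unfold Rd; rw [h1, h2]
    have h4 := h _ (D.simple_pos i)
    have h5 : z = (D.wordProd l)⁻¹ * D.s i := by
      rw [← inv_inv z, ← h1, wP_cons, mul_inv_rev, s_inv]
    have h6 : D.act (D.s i) (D.simple i) = - D.simple i := D.srefl_self (D.simple_mem i)
    rw [h5, act_mul, h6, map_neg] at h4
    exact D.not_pos_neg (D.rd_cons_pos h3) h4

theorem minR_unique {pi : D.V} (hpi : D.IsDominant pi) {x y : D.W} (hx : D.MinR pi x)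
    (hy : D.MinR pi y) (h : D.act x pi = D.act y pi) : x = y := by
  have hz : D.act (x⁻¹ * y) pi = pi := by rw [act_mul, ← h, act_inv_act]
  have : x⁻¹ * y = 1 := by
    apply D.eq_one_of_pos
    intro γ hγ
    by_contra hn
    have hn := D.act_neg_root _ hγ.1 hn
    have h1 : D.coroot (D.act (x⁻¹ * y) γ) pi = D.coroot γ pi := by
      conv_lhs => rw [← hz]
      exact D.coroot_act' hγ.1 _ _
    have h2 := D.dominant_nonneg hpi hγ
    have h3 := D.dominant_nonneg hpi hn
    rw [D.coroot_neg (D.roots_invariant _ _ hγ.1), h1] at h3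
    have h4 : D.coroot γ pi = 0 := by linarith
    by_cases h5 : D.IsPosRoot (D.act y γ)
    · have h6 := hx _ hn (by
        rw [map_neg, neg_neg, act_mul, act_act_inv]; exact h5)
      rw [D.coroot_neg (D.roots_invariant _ _ hγ.1), h1] at h6
      linarith
    · have := hy _ hγ (D.act_neg_root _ hγ.1 h5)
      linarith
  rwa [inv_mul_eq_one] at this

theorem exists_minR {pi : D.V} (hpi : D.IsDominant pi) (n : ℕ) : ∀ x : D.W, D.length x ≤ n →
    ∃ y, D.MinR pi y ∧ D.act y pi = D.act x pi ∧ D.bruhatLE y x := by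
  induction n with
  | zero =>
    intro x hx
    refine ⟨x, ?_, rfl, Relation.ReflTransGen.refl⟩
    obtain ⟨l, h1, h2⟩ := D.exists_reduced x
    have : l = [] := List.length_eq_zero_iff.1 (by omega)
    subst this
    rw [wP_nil] at h1
    subst h1
    intro γ h1 h2
    rw [act_one] at h2
    exact absurd h2 (D.not_pos_neg h1)
  | succ n ih =>
    intro x hx
    by_cases hm : D.MinR pi x
    · exact ⟨x, hm, rfl, Relation.ReflTransGen.refl⟩
    unfold MinR at hm
    push Not at hm
    obtain ⟨γ, h1, h2, h3⟩ := hm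
    have h4 : D.coroot γ pi = 0 := le_antisymm h3 (D.dominant_nonneg hpi h1)
    have hlt := D.length_lt (x := x) h2 (by rw [map_neg, act_inv_act, neg_neg]; exact h1)
    obtain ⟨y, e1, e2, e3⟩ := ih (D.srefl (-D.act x γ) * x) (by omega)
    refine ⟨y, e1, ?_, e3.trans (D.bruhat_step h2 hlt)⟩
    rw [e2, act_mul, D.srefl_apply _ h2.1, D.coroot_neg (D.roots_invariant _ _ h1.1),
      D.coroot_act' h1.1, h4]
    simp

theorem reduced_path {pi : D.V} (l : List D.I) : D.Rd l →
    (∀ γ, D.IsPosRoot γ → D.IsPosRoot (-D.act (D.wordProd l) γ) → D.coroot γ pi = 1) →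
    D.IsPath l pi := by
  induction l with
  | nil => intro _ _; trivial
  | cons i l ih =>
    intro h1 h2
    have hp := D.rd_cons_pos h1
    refine ⟨ih (D.rd_tail h1) fun γ h3 h4 => h2 γ h3 ?_, ?_⟩
    · rw [wP_cons, act_mul]
      apply D.act_neg_root _ (D.roots_invariant _ _ h3.1)
      intro h5
      obtain ⟨c, hc, he⟩ := D.simple_step h4 (i := i) (by rw [map_neg, neg_neg]; exact h5)
      have h6 : γ = -(c • D.act (D.wordProd l)⁻¹ (D.simple i)) := by
        rw [← map_smul, ← he, map_neg, act_inv_act, neg_neg]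
      have h7 := D.hf_pos h3
      have h8 := D.hf_pos hp
      rw [h6, map_neg, map_smul, smul_eq_mul] at h7
      nlinarith
    · rw [D.coroot_act (D.simple_mem i)]
      apply h2 _ hp
      rw [wP_cons, act_mul, act_act_inv]
      have h5 : D.act (D.s i) (D.simple i) = - D.simple i := D.srefl_self (D.simple_mem i)
      rw [h5, neg_neg]
      exact D.simple_pos i

theorem reduced_path' {pi : D.V} (hpi : D.IsDominant pi) {l m : List D.I} (hl : D.IsPath l pi)
    (hm : D.Rd m) (h : D.wordProd m = D.wordProd l) : D.IsPath m pi := by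
  apply D.reduced_path m hm
  intro γ h1 h2
  rw [h] at h2
  exact D.inv_pairing hpi hl h1 h2

theorem minR_tail {pi : D.V} {i : D.I} {l : List D.I} (h1 : D.Rd (i :: l))
    (h2 : D.MinR pi (D.wordProd (i :: l))) : D.MinR pi (D.wordProd l) := by
  intro γ h3 h4
  apply h2 γ h3
  have hp := D.rd_cons_pos h1
  rw [wP_cons, act_mul]
  apply D.act_neg_root _ (D.roots_invariant _ _ h3.1)
  intro h5
  obtain ⟨c, hc, he⟩ := D.simple_step h4 (i := i) (by rw [map_neg, neg_neg]; exact h5)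
  have h6 : γ = -(c • D.act (D.wordProd l)⁻¹ (D.simple i)) := by
    rw [← map_smul, ← he, map_neg, act_inv_act, neg_neg]
  have h7 := D.hf_pos h3
  have h8 := D.hf_pos hp
  rw [h6, map_neg, map_smul, smul_eq_mul] at h7
  nlinarith

/-- Bruhat order below a minuscule element is the weak order. -/
theorem sublist_weak {pi : D.V} (hpi : D.IsDominant pi) (l : List D.I) : ∀ m : List D.I,
    m.Sublist l → D.IsPath l pi → D.Rd m → D.MinR pi (D.wordProd m) →
    D.IsPath m pi ∧ ∃ q, D.wordProd q * D.wordProd m = D.wordProd l ∧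
      q.length + m.length = l.length ∧ D.IsPath q (D.act (D.wordProd m) pi) := by
  induction l with
  | nil =>
    intro m hm _ _ _
    have : m = [] := List.sublist_nil.1 hm
    subst this
    exact ⟨trivial, [], by simp [wP_nil], rfl, trivial⟩
  | cons i l ih =>
    rintro m hm ⟨hl, hi⟩ hr hmin
    cases hm with
    | cons _ hm =>
      obtain ⟨h1, q, h2, h3, h4⟩ := ih m hm hl hr hmin
      refine ⟨h1, i :: q, by rw [wP_cons, wP_cons, mul_assoc, h2], by simp; omega, h4, ?_⟩
      rw [← act_mul, h2]; exact hi
    | cons_cons _ hm =>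
      rename_i m
      obtain ⟨h1, q, h2, h3, h4⟩ := ih m hm hl (D.rd_tail hr) (D.minR_tail hr hmin)
      have hp := D.rd_cons_pos hr
      have h5 := hmin _ hp (by
        have h5 : D.act (D.s i) (D.simple i) = - D.simple i := D.srefl_self (D.simple_mem i)
        rw [wP_cons, act_mul, act_act_inv, h5, neg_neg]
        exact D.simple_pos i)
      rw [← D.coroot_act (D.simple_mem i)] at h5
      obtain ⟨n, hn⟩ := D.path_integral hpi (D.wordProd m) i
      have h6 : 1 ≤ D.coroot (D.simple i) (D.act (D.wordProd m) pi) := by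
        rw [hn] at h5 ⊢
        have : 0 < n := by exact_mod_cast h5
        exact_mod_cast this
      obtain ⟨e1, q', e2, e3, e4⟩ := D.diamond i q _ ⟨h4, by rw [← act_mul, h2]; exact hi⟩ h6
      refine ⟨⟨h1, e1⟩, q', ?_, by simp; omega, ?_⟩
      · rw [wP_cons, ← mul_assoc, e3, mul_assoc, h2, wP_cons]
      · rw [wP_cons, act_mul]; exact e2

/-! ### The localization function -/

/-- precomposition of a functional with a group element -/
noncomputable def tw (h : D.V →ₗ[ℚ] ℚ) (g : D.W) : D.V →ₗ[ℚ] ℚ :=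
  h.comp (D.act g).toLinearMap

theorem tw_apply (h : D.V →ₗ[ℚ] ℚ) (g : D.W) (x : D.V) : D.tw h g x = h (D.act g x) := rfl

theorem tw_one (h : D.V →ₗ[ℚ] ℚ) : D.tw h 1 = h := by
  ext x; simp [tw_apply]

theorem tw_mul (h : D.V →ₗ[ℚ] ℚ) (g k : D.W) : D.tw h (g * k) = D.tw (D.tw h g) k := by
  ext x; simp [tw_apply]

/-- the value at the weight `x` of the localization of a Schubert class, computed from a word
by summing over subwords -/
noncomputable def loc (pi : D.V) : List D.I → (D.V →ₗ[ℚ] ℚ) → D.V → ℚ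
  | [], _, x => if x = pi then 1 else 0
  | i :: l, h, x => loc pi l (D.tw h (D.s i)) x + h (D.simple i) *
      (if D.coroot (D.simple i) x = -1 then
        loc pi l (D.tw h (D.s i)) (x + D.simple i) else 0)

/-- the product of the values of `h` at the roots attached to a word -/
noncomputable def prodL : List D.I → (D.V →ₗ[ℚ] ℚ) → ℚ
  | [], _ => 1
  | i :: l, h => h (D.simple i) * prodL l (D.tw h (D.s i))

theorem loc_support {pi : D.V} (l : List D.I) : D.IsPath l pi →
    ∀ (h : D.V →ₗ[ℚ] ℚ) (x : D.V), D.loc pi l h x ≠ 0 →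
    ∃ m q, D.IsPath m pi ∧ D.act (D.wordProd m) pi = x ∧ D.IsPath q x ∧
      D.act (D.wordProd q) x = D.act (D.wordProd l) pi := by
  induction l with
  | nil =>
    intro _ h x hx
    simp only [loc] at hx
    by_cases hxp : x = pi
    · subst hxp
      exact ⟨[], [], trivial, by rw [wP_nil, act_one], trivial, rfl⟩
    · simp [hxp] at hx
  | cons i l ih =>
    rintro ⟨hl, hi⟩ h x hx
    by_cases h1 : D.loc pi l (D.tw h (D.s i)) x ≠ 0
    · obtain ⟨m, q, e1, e2, e3, e4⟩ := ih hl _ x h1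
      refine ⟨m, i :: q, e1, e2, ⟨e3, by rw [e4]; exact hi⟩, ?_⟩
      rw [wP_cons, wP_cons, act_mul, act_mul, e4]
    · push Not at h1
      simp only [loc, h1, zero_add] at hx
      by_cases h2 : D.coroot (D.simple i) x = -1
      · rw [if_pos h2] at hx
        obtain ⟨m, q, e1, e2, e3, e4⟩ := ih hl _ _ (right_ne_zero_of_mul hx)
        have h3 : D.coroot (D.simple i) (x + D.simple i) = 1 := by
          rw [map_add, h2, D.coroot_self _ (D.simple_mem i)]; norm_num
        have h4 : D.act (D.s i) (x + D.simple i) = x := by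
          rw [s_act, h3]; module
        obtain ⟨-, q', f1, f2, -⟩ := D.diamond i q _ ⟨e3, by rw [e4]; exact hi⟩ h3.ge
        rw [h4] at f1
        refine ⟨i :: m, q', ⟨e1, by rw [e2]; exact h3⟩, ?_, f1, ?_⟩
        · rw [wP_cons, act_mul, e2, h4]
        · conv_lhs => rw [← h4]
          rw [← act_mul, f2, act_mul, e4, wP_cons, act_mul]
      · simp [h2] at hx

theorem loc_rec {pi : D.V} (hpi : D.IsDominant pi) (l : List D.I) : D.IsPath l pi →
    ∀ (h : D.V →ₗ[ℚ] ℚ) (x : D.V),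
    (h x - h (D.act (D.wordProd l) pi)) * D.loc pi l h x =
      ∑ j, if D.coroot (D.simple j) x = 1 then D.loc pi l h (x - D.simple j) else 0 := by
  induction l with
  | nil =>
    intro _ h x
    have h1 : ∀ j, (if D.coroot (D.simple j) x = 1 then D.loc pi [] h (x - D.simple j)
        else 0) = 0 := by
      intro j
      split_ifs with hj
      · simp only [loc]
        rw [if_neg]
        intro he
        have h2 := hpi.2 j
        rw [← he, map_sub, hj, D.coroot_self _ (D.simple_mem j)] at h2
        norm_num at h2
      · rfl
    simp only [h1, Finset.sum_const_zero]
    simp only [loc, wP_nil, act_one]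
    split_ifs with hx
    · rw [hx]; ring
    · ring
  | cons i l ih =>
    rintro ⟨hl, hi⟩ h x
    have IH := ih hl (D.tw h (D.s i))
    have hlow : ∀ y, D.loc pi l (D.tw h (D.s i)) y ≠ 0 → ∀ j, -1 ≤ D.coroot (D.simple j) y := by
      intro y hy j
      obtain ⟨m, q, e1, e2, e3, e4⟩ := D.loc_support l hl _ y hy
      rw [← e2]
      exact D.path_predominant hpi m e1 _ (D.simple_pos j)
    have hupp : ∀ y, D.loc pi l (D.tw h (D.s i)) y ≠ 0 → D.coroot (D.simple i) y ≤ 1 := by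
      intro y hy
      obtain ⟨m, q, e1, e2, e3, e4⟩ := D.loc_support l hl _ y hy
      by_contra hlt
      push Not at hlt
      have := (D.diamond i q y ⟨e3, by rw [e4]; exact hi⟩ hlt.le).1
      linarith
    have hintg : ∀ y, D.loc pi l (D.tw h (D.s i)) y ≠ 0 →
        ∃ n : ℤ, D.coroot (D.simple i) y = n := by
      intro y hy
      obtain ⟨m, q, e1, e2, e3, e4⟩ := D.loc_support l hl _ y hy
      rw [← e2]
      exact D.path_integral hpi _ i
    simp only [loc, wP_cons, act_mul]
    simp only [tw_apply] at IH
    generalize D.loc pi l (D.tw h (D.s i)) = g at *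
    generalize h (D.act (D.s i) (D.act (D.wordProd l) pi)) = c at *
    have hself := D.coroot_self _ (D.simple_mem i)
    have key : D.coroot (D.simple i) x * g x +
        (h x - c) * (if D.coroot (D.simple i) x = -1 then g (x + D.simple i) else 0) =
        ∑ j, if D.coroot (D.simple j) x = 1 then
          (if D.coroot (D.simple i) (x - D.simple j) = -1 then
            g (x - D.simple j + D.simple i) else 0) else 0 := by
      by_cases hp : D.coroot (D.simple i) x = -1
      · rw [if_pos hp, hp]
        have hx1 : D.coroot (D.simple i) (x + D.simple i) = 1 := by
          rw [map_add, hp, hself]; norm_num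
        have h1 := IH (x + D.simple i)
        have h4 : D.act (D.s i) (x + D.simple i) = x := by
          rw [s_act, hx1]; module
        rw [h4] at h1
        rw [h1]
        have h2 : ∀ j, (if D.coroot (D.simple j) (x + D.simple i) = 1 then
            g (x + D.simple i - D.simple j) else 0) =
            (if D.coroot (D.simple j) x = 1 then
              (if D.coroot (D.simple i) (x - D.simple j) = -1 then
                g (x - D.simple j + D.simple i) else 0) else 0) +
            (if j = i then g x else 0) := by
          intro j
          by_cases hj : j = i
          · subst hj
            rw [if_pos hx1, if_pos rfl, if_neg (by rw [hp]; norm_num), add_sub_cancel_right,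
              zero_add]
          · rw [if_neg hj, add_zero, map_add, map_sub, hp]
            have hc : x - D.simple j + D.simple i = x + D.simple i - D.simple j := by abel
            rcases D.cartan_cases hj with h0 | h0
            · rw [h0, D.cartan_zero h0, add_zero, sub_zero, if_pos rfl, hc]
            · have h0' := D.cartan_neg hj h0
              rw [if_neg (by linarith : ¬ (-1 - D.coroot (D.simple i) (D.simple j) = -1)),
                ite_self]
              have : g (x + D.simple i - D.simple j) = 0 := by
                by_contra hg
                have := hupp _ hg
                rw [map_sub, hx1] at this
                linarith
              rw [this, ite_self]
        rw [Finset.sum_congr rfl fun j _ => h2 j, Finset.sum_add_distrib]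
        simp
      · rw [if_neg hp, mul_zero, add_zero]
        have h2 : ∀ j, (if D.coroot (D.simple j) x = 1 then
              (if D.coroot (D.simple i) (x - D.simple j) = -1 then
                g (x - D.simple j + D.simple i) else 0) else 0) =
            if j = i then D.coroot (D.simple i) x * g x else 0 := by
          intro j
          by_cases hj : j = i
          · subst hj
            rw [if_pos rfl, map_sub, hself, sub_add_cancel]
            by_cases h1 : D.coroot (D.simple j) x = 1
            · rw [if_pos h1, h1, if_pos (by norm_num), one_mul]
            · rw [if_neg h1]
              by_cases hg : g x = 0
              · rw [hg, mul_zero]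
              · obtain ⟨n, hn⟩ := hintg x hg
                have h3 := hupp x hg
                have h4 := hlow x hg j
                rw [hn] at h1 hp h3 h4 ⊢
                have h3' : n ≤ 1 := by exact_mod_cast h3
                have h4' : -1 ≤ n := by exact_mod_cast h4
                have h1' : n ≠ 1 := by exact_mod_cast h1
                have hp' : n ≠ -1 := by exact_mod_cast hp
                have : n = 0 := by omega
                rw [this]; simp
          · rw [if_neg hj]
            split_ifs with h3 h4
            · rw [map_sub] at h4
              rcases D.cartan_cases (Ne.symm hj) with h0 | h0
              · exact absurd (by linarith) hp
              · have h0' := D.cartan_neg (Ne.symm hj) h0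
                by_contra hg
                have := hlow _ hg j
                rw [map_add, map_sub, h3, D.coroot_self _ (D.simple_mem j)] at this
                linarith
            · rfl
            · rfl
        rw [Finset.sum_congr rfl fun j _ => h2 j]
        simp
    have hx := IH x
    rw [s_act, map_sub, map_smul, smul_eq_mul] at hx
    have hsplit : (∑ j, if D.coroot (D.simple j) x = 1 then
          g (x - D.simple j) + h (D.simple i) *
            (if D.coroot (D.simple i) (x - D.simple j) = -1 then
              g (x - D.simple j + D.simple i) else 0) else 0) =
        (∑ j, if D.coroot (D.simple j) x = 1 then g (x - D.simple j) else 0) +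
        h (D.simple i) * ∑ j, if D.coroot (D.simple j) x = 1 then
          (if D.coroot (D.simple i) (x - D.simple j) = -1 then
            g (x - D.simple j + D.simple i) else 0) else 0 := by
      rw [Finset.mul_sum, ← Finset.sum_add_distrib]
      refine Finset.sum_congr rfl fun j _ => ?_
      by_cases h1 : D.coroot (D.simple j) x = 1
      · simp only [if_pos h1]
      · simp only [if_neg h1, mul_zero, add_zero]
    rw [hsplit, ← hx, ← key]
    ring

theorem loc_bot {pi : D.V} (hpi : D.IsDominant pi) (l : List D.I) :
    ∀ h : D.V →ₗ[ℚ] ℚ, D.loc pi l h pi = 1 := by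
  induction l with
  | nil => intro h; simp [loc]
  | cons i l ih =>
    intro h
    simp only [loc]
    rw [ih, if_neg, mul_zero, add_zero]
    intro h1
    have := hpi.2 i
    rw [h1] at this
    norm_num at this

theorem loc_top {pi : D.V} (l : List D.I) : D.IsPath l pi → ∀ h : D.V →ₗ[ℚ] ℚ,
    D.loc pi l h (D.act (D.wordProd l) pi) = D.prodL l h := by
  induction l with
  | nil => intro _ h; simp [loc, prodL, wP_nil]
  | cons i l ih =>
    rintro ⟨hl, hi⟩ h
    have h1 : D.act (D.wordProd (i :: l)) pi = D.act (D.wordProd l) pi - D.simple i := by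
      rw [wP_cons, act_mul, s_act, hi, one_smul]
    simp only [loc, prodL]
    rw [h1, map_sub, hi, D.coroot_self _ (D.simple_mem i), if_pos (by norm_num), sub_add_cancel,
      ih hl]
    have : D.loc pi l (D.tw h (D.s i)) (D.act (D.wordProd l) pi - D.simple i) = 0 := by
      by_contra hn
      obtain ⟨m, q, e1, e2, e3, e4⟩ := D.loc_support l hl _ _ hn
      have h2 := D.hf_path e3
      rw [e4, map_sub, hf_simple] at h2
      have h3 : (0 : ℚ) ≤ q.length := by positivity
      linarith
    rw [this, zero_add]

/-- positivity of `h` along the roots of a word -/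
def PosL : List D.I → (D.V →ₗ[ℚ] ℚ) → Prop
  | [], _ => True
  | i :: l, h => 0 < h (D.simple i) ∧ PosL l (D.tw h (D.s i))

theorem loc_nonneg {pi : D.V} (l : List D.I) : ∀ h, D.PosL l h → ∀ x, 0 ≤ D.loc pi l h x := by
  induction l with
  | nil => intro h _ x; simp only [loc]; split_ifs <;> norm_num
  | cons i l ih =>
    rintro h ⟨h1, h2⟩ x
    simp only [loc]
    have h3 := ih _ h2 x
    have h4 := ih _ h2 (x + D.simple i)
    split_ifs
    · have := mul_nonneg h1.le h4
      linarith
    · simpa using h3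

theorem loc_sublist_pos {pi : D.V} (l : List D.I) : ∀ h, D.PosL l h → ∀ m : List D.I,
    m.Sublist l → D.IsPath m pi → 0 < D.loc pi l h (D.act (D.wordProd m) pi) := by
  induction l with
  | nil =>
    intro h _ m hm _
    rw [List.sublist_nil.1 hm]
    simp [loc, wP_nil]
  | cons i l ih =>
    rintro h ⟨h1, h2⟩ m hm hp
    cases hm with
    | cons _ hm =>
      have h3 := ih _ h2 m hm hp
      have h4 := D.loc_nonneg (pi := pi) l _ h2 (D.act (D.wordProd m) pi + D.simple i)
      simp only [loc]
      split_ifs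
      · have := mul_nonneg h1.le h4
        linarith
      · simpa using h3
    | cons_cons _ hm =>
      rename_i m
      obtain ⟨hp, hi⟩ := hp
      have h3 := ih _ h2 m hm hp
      have e1 : D.act (D.wordProd (i :: m)) pi = D.act (D.wordProd m) pi - D.simple i := by
        rw [wP_cons, act_mul, s_act, hi, one_smul]
      have h4 := D.loc_nonneg (pi := pi) l _ h2 (D.act (D.wordProd m) pi - D.simple i)
      simp only [loc]
      rw [e1, map_sub, hi, D.coroot_self _ (D.simple_mem i), if_pos (by norm_num),
        sub_add_cancel]
      have := mul_pos h1 h3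
      linarith

theorem loc_append_ge {pi : D.V} (k l : List D.I) : ∀ h, D.PosL (k ++ l) h → ∀ x,
    D.loc pi l (D.tw h (D.wordProd k)) x ≤ D.loc pi (k ++ l) h x := by
  induction k with
  | nil => intro h _ x; rw [wP_nil, tw_one]; rfl
  | cons i k ih =>
    rintro h ⟨h1, h2⟩ x
    have h3 := ih _ h2 x
    have h4 := D.loc_nonneg (pi := pi) (k ++ l) _ h2 (x + D.simple i)
    rw [wP_cons, tw_mul]
    simp only [List.cons_append, loc]
    split_ifs
    · have := mul_nonneg h1.le h4
      linarith
    · simpa using h3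

theorem loc_append_gt {pi : D.V} (k l : List D.I) : ∀ h, D.PosL (k ++ l) h → ∀ m n : List D.I,
    m.Sublist k → n.Sublist l → m ≠ [] → D.IsPath (m ++ n) pi →
    D.loc pi l (D.tw h (D.wordProd k)) (D.act (D.wordProd (m ++ n)) pi) <
      D.loc pi (k ++ l) h (D.act (D.wordProd (m ++ n)) pi) := by
  induction k with
  | nil => intro h _ m n hm _ h0; exact absurd (List.sublist_nil.1 hm) h0
  | cons i k ih =>
    rintro h ⟨h1, h2⟩ m n hm hn h0 hp
    rw [wP_cons, tw_mul]
    cases hm with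
    | cons _ hm =>
      have h3 := ih _ h2 m n hm hn h0 hp
      have h4 := D.loc_nonneg (pi := pi) (k ++ l) _ h2
        (D.act (D.wordProd (m ++ n)) pi + D.simple i)
      simp only [List.cons_append, loc]
      split_ifs
      · have := mul_nonneg h1.le h4
        linarith
      · simpa using h3
    | cons_cons _ hm =>
      rename_i m
      obtain ⟨hp, hi⟩ := hp
      change D.coroot (D.simple i) (D.act (D.wordProd (m ++ n)) pi) = 1 at hi
      have h3 := D.loc_sublist_pos (pi := pi) (k ++ l) _ h2 (m ++ n) (hm.append hn) hp
      have h4 := D.loc_append_ge (pi := pi) k l _ h2 (D.act (D.wordProd (i :: m ++ n)) pi)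
      have e1 : D.act (D.wordProd (i :: m ++ n)) pi =
          D.act (D.wordProd (m ++ n)) pi - D.simple i := by
        rw [List.cons_append, wP_cons, act_mul, s_act, hi, one_smul]
      rw [e1] at h4 ⊢
      simp only [List.cons_append, loc]
      rw [map_sub, hi, D.coroot_self _ (D.simple_mem i), if_pos (by norm_num),
        sub_add_cancel]
      have := mul_pos h1 h3
      linarith

theorem prodL_append (k l : List D.I) : ∀ h,
    D.prodL (k ++ l) h = D.prodL k h * D.prodL l (D.tw h (D.wordProd k)) := by
  induction k with
  | nil => intro h; simp [prodL, wP_nil, tw_one]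
  | cons i k ih =>
    intro h
    simp only [List.cons_append, prodL, ih, wP_cons, tw_mul]
    ring

/-! ### Counting paths -/

/-- the finite set of path words of length `n` from a given weight to `ν` -/
noncomputable def pathSet (ν : D.V) : ℕ → D.V → Finset (List D.I)
  | 0, x => if x = ν then {[]} else ∅
  | n + 1, x => Finset.univ.biUnion fun j =>
      if D.coroot (D.simple j) x = 1 then
        (pathSet ν n (x - D.simple j)).image (fun q => q ++ [j]) else ∅

theorem mem_pathSet (ν : D.V) (n : ℕ) : ∀ (x : D.V) (q : List D.I), q ∈ D.pathSet ν n x ↔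
    q.length = n ∧ D.IsPath q x ∧ D.act (D.wordProd q) x = ν := by
  induction n with
  | zero =>
    intro x q
    simp only [pathSet]
    constructor
    · intro h
      split_ifs at h with hx
      · rw [Finset.mem_singleton] at h
        subst h
        exact ⟨rfl, trivial, by rw [wP_nil, act_one, hx]⟩
      · simp at h
    · rintro ⟨h1, h2, h3⟩
      have : q = [] := List.length_eq_zero_iff.1 h1
      subst this
      rw [wP_nil, act_one] at h3
      simp [h3]
  | succ n ih =>
    intro x q
    simp only [pathSet, Finset.mem_biUnion, Finset.mem_univ, true_and]
    constructor
    · rintro ⟨j, hj⟩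
      split_ifs at hj with h1
      · obtain ⟨q', h2, rfl⟩ := Finset.mem_image.1 hj
        obtain ⟨e1, e2, e3⟩ := (ih _ _).1 h2
        have e4 : D.act (D.s j) x = x - D.simple j := by rw [s_act, h1, one_smul]
        refine ⟨by simp [e1], (D.isPath_concat _ _ _).2 ⟨h1, by rw [e4]; exact e2⟩, ?_⟩
        rw [wP_append, act_mul, wP_cons, wP_nil, mul_one, e4, e3]
      · simp at hj
    · rintro ⟨h1, h2, h3⟩
      rcases List.eq_nil_or_concat q with rfl | ⟨q', j, rfl⟩
      · simp at h1
      · rw [List.concat_eq_append] at h1 h2 h3 ⊢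
        rw [isPath_concat] at h2
        obtain ⟨h2, h4⟩ := h2
        have e4 : D.act (D.s j) x = x - D.simple j := by rw [s_act, h2, one_smul]
        refine ⟨j, ?_⟩
        rw [if_pos h2]
        refine Finset.mem_image.2 ⟨q', (ih _ _).2 ⟨by simpa using h1, by rw [← e4]; exact h4, ?_⟩,
          rfl⟩
        rw [wP_append, act_mul, wP_cons, wP_nil, mul_one, e4] at h3
        exact h3

theorem card_pathSet_succ (ν : D.V) (n : ℕ) (x : D.V) : (D.pathSet ν (n + 1) x).card =
    ∑ j, if D.coroot (D.simple j) x = 1 then (D.pathSet ν n (x - D.simple j)).card else 0 := by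
  rw [pathSet, Finset.card_biUnion]
  · refine Finset.sum_congr rfl fun j _ => ?_
    split_ifs
    · rw [Finset.card_image_of_injective]
      intro a b hab
      exact List.append_cancel_right hab
    · rfl
  · intro j _ k _ hjk
    rw [Function.onFun, Finset.disjoint_left]
    intro q h1 h2
    split_ifs at h1 with h3
    · split_ifs at h2 with h4
      · obtain ⟨a, -, rfl⟩ := Finset.mem_image.1 h1
        obtain ⟨b, -, hb⟩ := Finset.mem_image.1 h2
        have := (List.append_inj' hb rfl).2
        simp at this
        exact hjk this.symm
      · simp at h2
    · simp at h1

theorem loc_count {pi : D.V} (hpi : D.IsDominant pi) {l : List D.I} (hl : D.IsPath l pi)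
    (n : ℕ) : ∀ x : D.V, D.hf x - D.hf (D.act (D.wordProd l) pi) = n →
    D.loc pi l D.hf x * n.factorial =
      (D.pathSet (D.act (D.wordProd l) pi) n x).card *
        D.loc pi l D.hf (D.act (D.wordProd l) pi) := by
  induction n with
  | zero =>
    intro x hx
    by_cases h : x = D.act (D.wordProd l) pi
    · subst h
      simp [pathSet]
    · have : D.loc pi l D.hf x = 0 := by
        by_contra hn
        obtain ⟨m, q, e1, e2, e3, e4⟩ := D.loc_support l hl _ _ hn
        have h2 := D.hf_path e3
        rw [e4] at h2
        have h3 : (q.length : ℚ) = 0 := by push_cast at hx; linarith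
        have h4 : q = [] := List.length_eq_zero_iff.1 (by exact_mod_cast h3)
        subst h4
        rw [wP_nil, act_one] at e4
        exact h e4
      rw [this]
      simp [pathSet, h]
  | succ n ih =>
    intro x hx
    have h1 := D.loc_rec hpi l hl D.hf x
    rw [hx] at h1
    rw [card_pathSet_succ, Nat.factorial_succ, Nat.cast_sum, Finset.sum_mul]
    push_cast at h1 ⊢
    rw [show D.loc pi l D.hf x * ((n + 1 : ℚ) * n.factorial) =
      ((n + 1 : ℚ) * D.loc pi l D.hf x) * n.factorial by ring, h1, Finset.sum_mul]
    refine Finset.sum_congr rfl fun j _ => ?_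
    split_ifs with hj
    · rw [ih]
      rw [map_sub, hf_simple]
      push_cast at hx
      linarith
    · simp

/-! ### Roots of a word -/

/-- the list of roots attached to a word -/
noncomputable def rootsL : List D.I → List D.V
  | [] => []
  | i :: l => D.simple i :: (rootsL l).map (D.act (D.s i))

theorem mem_rootsL (l : List D.I) : ∀ β, β ∈ D.rootsL l ↔
    ∃ A i B, l = A ++ i :: B ∧ β = D.act (D.wordProd A) (D.simple i) := by
  induction l with
  | nil => intro β; simp [rootsL]
  | cons i l ih =>
    intro β
    simp only [rootsL, List.mem_cons, List.mem_map]
    constructor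
    · rintro (rfl | ⟨β', h1, rfl⟩)
      · exact ⟨[], i, l, rfl, by rw [wP_nil, act_one]⟩
      · obtain ⟨A, j, B, rfl, rfl⟩ := (ih _).1 h1
        exact ⟨i :: A, j, B, rfl, by rw [wP_cons, act_mul]⟩
    · rintro ⟨A, j, B, h1, rfl⟩
      cases A with
      | nil =>
        simp at h1
        left
        rw [h1.1, wP_nil, act_one]
      | cons k A =>
        simp at h1
        right
        exact ⟨_, (ih _).2 ⟨A, j, B, h1.2, rfl⟩, by rw [h1.1, wP_cons, act_mul]⟩

theorem prodL_eq (l : List D.I) : ∀ h, D.prodL l h = ((D.rootsL l).map h).prod := by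
  induction l with
  | nil => intro h; simp [prodL, rootsL]
  | cons i l ih =>
    intro h
    simp only [prodL, rootsL, List.map_cons, List.prod_cons, ih, List.map_map]
    rfl

theorem posL_of (l : List D.I) : ∀ h, (∀ β ∈ D.rootsL l, 0 < h β) → D.PosL l h := by
  induction l with
  | nil => intro h _; trivial
  | cons i l ih =>
    intro h hh
    simp only [rootsL, List.mem_cons, List.mem_map, forall_eq_or_imp] at hh
    exact ⟨hh.1, ih _ fun β hβ => hh.2 _ ⟨β, hβ, rfl⟩⟩

theorem rootsL_pos {l : List D.I} (hl : D.Rd l) {β : D.V} (hβ : β ∈ D.rootsL l) :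
    D.IsPosRoot β := by
  obtain ⟨A, i, B, rfl, rfl⟩ := (D.mem_rootsL _ _).1 hβ
  by_contra hn
  have hr := D.roots_invariant (D.wordProd A) _ (D.simple_mem i)
  have hn := D.act_neg_root _ (D.simple_mem i) hn
  have h1 := D.length_lt (x := D.wordProd A) hn (by
    rw [map_neg, neg_neg, act_inv_act]; exact D.simple_pos i)
  have e : (-1 : ℚ) • D.act (D.wordProd A) (D.simple i) =
      - D.act (D.wordProd A) (D.simple i) := by module
  have h2 := D.srefl_smul (c := -1) (by norm_num) hr (by rw [e]; exact hn.1)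
  rw [e] at h2
  rw [h2, D.srefl_conj (D.simple_mem i), inv_mul_cancel_right] at h1
  have h3 : D.Rd (A ++ [i]) := D.rd_left (m := B) (by simpa using hl)
  have h4 := D.rd_left h3
  unfold Rd at h3 h4
  rw [wP_append, wP_cons, wP_nil, mul_one] at h3
  change D.length (D.wordProd A * D.s i) < _ at h1
  simp at h3
  omega

theorem rootsL_nodup (l : List D.I) : D.Rd l → (D.rootsL l).Nodup := by
  induction l with
  | nil => intro _; simp [rootsL]
  | cons i l ih =>
    intro h
    simp only [rootsL, List.nodup_cons, List.mem_map]
    refine ⟨?_, (ih (D.rd_tail h)).map (D.act (D.s i)).injective⟩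
    rintro ⟨β, h1, h2⟩
    have h3 := D.rootsL_pos (D.rd_tail h) h1
    have h4 : β = - D.simple i := by
      rw [← D.s_act_s i β, h2]
      exact D.srefl_self (D.simple_mem i)
    rw [h4] at h3
    exact D.not_pos_neg (D.simple_pos i) h3

/-! ### Assembling -/

theorem redCard_eq {pi : D.V} (hpi : D.IsDominant pi) {q m : List D.I}
    (hp : D.IsPath (q ++ m) pi) (hr : D.Rd (q ++ m)) :
    D.RedCard (D.wordProd q) = (D.pathSet (D.act (D.wordProd (q ++ m)) pi) q.length
      (D.act (D.wordProd m) pi)).card := by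
  unfold RedCard
  have hq := D.rd_left hr
  have hm := D.rd_right hr
  have : {l : List D.I | D.IsReduced l (D.wordProd q)} =
      ↑(D.pathSet (D.act (D.wordProd (q ++ m)) pi) q.length (D.act (D.wordProd m) pi)) := by
    ext l
    rw [Finset.mem_coe, mem_pathSet]
    constructor
    · rintro ⟨h1, h2⟩
      have h3 : D.wordProd (l ++ m) = D.wordProd (q ++ m) := by rw [wP_append, wP_append, h1]
      have h4 : l.length = q.length := by rw [h2, ← hq]
      have h5 : D.Rd (l ++ m) := by
        unfold Rd at *
        rw [h3, ← hr]; simp [h4]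
      have h6 := D.reduced_path' hpi hp h5 h3
      rw [isPath_append] at h6
      exact ⟨h4, h6.2, by rw [← act_mul, ← wP_append, h3]⟩
    · rintro ⟨h1, h2, h3⟩
      have h4 : D.IsPath (l ++ m) pi :=
        (D.isPath_append _ _ _).2 ⟨((D.isPath_append _ _ _).1 hp).1, h2⟩
      have h5 := D.minR_unique hpi (D.path_minR hpi h4) (D.path_minR hpi hp)
        (by rw [wP_append, act_mul, h3])
      rw [wP_append, wP_append] at h5
      exact ⟨mul_right_cancel h5, by rw [h1, hq]⟩
  calc Nat.card {l : List D.I // D.IsReduced l (D.wordProd q)}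
      = Nat.card ↥{l : List D.I | D.IsReduced l (D.wordProd q)} := rfl
    _ = _ := by rw [this]; simp

theorem skew_count {pi : D.V} (hpi : D.IsDominant pi) {q m : List D.I}
    (hp : D.IsPath (q ++ m) pi) (hr : D.Rd (q ++ m)) :
    D.loc pi (q ++ m) D.hf (D.act (D.wordProd m) pi) * q.length.factorial =
      D.RedCard (D.wordProd q) * D.prodL (q ++ m) D.hf := by
  rw [D.redCard_eq hpi hp hr, ← D.loc_top _ hp]
  apply D.loc_count hpi hp
  have h := ((D.isPath_append _ _ _).1 hp).2
  have := D.hf_path h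
  rw [wP_append, act_mul, this]
  ring

theorem peterson {pi : D.V} (hpi : D.IsDominant pi) {q : List D.I}
    (hp : D.IsPath q pi) (hr : D.Rd q) :
    (q.length.factorial : ℚ) = D.RedCard (D.wordProd q) * D.prodL q D.hf := by
  have := D.skew_count hpi (q := q) (m := []) (by simpa using hp) (by simpa using hr)
  rw [wP_nil, act_one, loc_bot D hpi] at this
  simpa using this

theorem root_pairing {pi : D.V} {A B : List D.I} {i : D.I}
    (hp : D.IsPath (A ++ i :: B) pi) :
    D.coroot (D.act (D.wordProd A) (D.simple i)) (D.act (D.wordProd (A ++ i :: B)) pi) = -1 := by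
  rw [wP_append, wP_cons, act_mul, act_mul, D.coroot_act' (D.simple_mem i), pairing_s_self]
  rw [((D.isPath_append _ _ _).1 hp).1.2]

theorem skew_mem {pi pi' : D.V} (hpi : D.IsDominant pi) (hpi' : D.IsDominant pi')
    {q m : List D.I} (hp : D.IsPath (q ++ m) pi) (hr : D.Rd (q ++ m)) (hq : D.IsPath q pi')
    (β : D.V) : β ∈ D.SsetSkew (D.wordProd m) (D.wordProd (q ++ m)) ↔ β ∈ D.rootsL q := by
  have hrq := D.rd_left hr
  have hrm := D.rd_right hr
  have hpm := ((D.isPath_append _ _ _).1 hp).1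
  unfold SsetSkew
  rw [Finset.mem_filter]
  constructor
  · rintro ⟨-, hβ, h1, h2, h3⟩
    have hlt := (D.bruhat_length h2).resolve_left h3
    have hneg := D.neg_of_lt hβ hlt
    obtain ⟨A, i, B, c, e1, hc, he⟩ := D.exchange _ _ hβ hneg
    have hmem : D.act (D.wordProd A) (D.simple i) ∈ D.rootsL (q ++ m) :=
      (D.mem_rootsL _ _).2 ⟨A, i, B, e1, rfl⟩
    have hpos := D.rootsL_pos hr hmem
    have hc1 : c = 1 := by
      have h4 := D.inv_pairing hpi hp hneg (by rw [map_neg, neg_neg, act_act_inv]; exact hβ)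
      rw [D.coroot_neg (D.roots_invariant _ _ hβ.1), ← D.coroot_act hβ.1] at h4
      have h5 := D.coroot_smul hc.ne' hpos.1 (he ▸ hβ.1) (D.act (D.wordProd (q ++ m)) pi)
      rw [← he] at h5
      have h6 := D.root_pairing (pi := pi) (A := A) (B := B) (i := i) (by rw [← e1]; exact hp)
      rw [← e1] at h6
      rw [h6] at h5
      have h7 : D.coroot β (D.act (D.wordProd (q ++ m)) pi) = -1 := by linarith
      rw [h7] at h5
      linarith
    rw [hc1, one_smul] at he
    have hcase : (∃ A', A = q ++ A' ∧ m = A' ++ i :: B) ∨ (∃ C, q = A ++ i :: C) := by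
      rcases List.append_eq_append_iff.1 e1 with ⟨A', e2, e3⟩ | ⟨C, e2, e3⟩
      · exact Or.inl ⟨A', e2, e3⟩
      · cases C with
        | nil => exact Or.inl ⟨[], by simpa using e2.symm, by simpa using e3.symm⟩
        | cons k C =>
          simp at e3
          exact Or.inr ⟨C, by rw [e2, e3.1]⟩
    rcases hcase with ⟨A', e2, e3⟩ | ⟨C, e2⟩
    · exfalso
      rw [D.exchange_del hβ e1 one_pos (by rw [one_smul]; exact he), e2, List.append_assoc] at h1
      obtain ⟨n, n1, n2, n3⟩ := D.bruhat_subword h1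
      obtain ⟨a, b, rfl, ha, hb⟩ := List.sublist_append_iff.1 n1
      have hb' : b.Sublist m := by
        rw [e3]
        exact hb.trans ((List.sublist_cons_self i B).append_left A')
      have hne : a ≠ [] := by
        rintro rfl
        have l1 := hb.length_le
        have l2 : m.length = A'.length + (B.length + 1) := by rw [e3]; simp
        unfold Rd at n3 hrm
        rw [n2, ← hrm] at n3
        simp at n3 l1
        omega
      have hpos : D.PosL (q ++ m) D.hf :=
        D.posL_of _ _ fun β hβ => D.hf_pos (D.rootsL_pos hr hβ)
      have hgt := D.loc_append_gt (pi := pi) q m D.hf hpos a b ha hb' hne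
        (D.reduced_path' hpi hpm n3 n2)
      rw [n2, D.loc_top m hpm] at hgt
      have k1 := D.skew_count hpi hp hr
      have k2 := D.peterson hpi' hq hrq
      rw [prodL_append, ← mul_assoc, ← k2, mul_comm] at k1
      have k3 := mul_left_cancel₀ (by positivity) k1
      rw [k3] at hgt
      exact lt_irrefl _ hgt
    · exact (D.mem_rootsL _ _).2 ⟨A, i, C, e2, he⟩
  · intro hβq
    have hβ := D.rootsL_pos hrq hβq
    obtain ⟨A, i, B, e1, he⟩ := (D.mem_rootsL _ _).1 hβq
    have hdel : D.srefl β * D.wordProd q = D.wordProd (A ++ B) :=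
      D.exchange_del hβ e1 one_pos (by rw [one_smul]; exact he)
    have hdel' : D.srefl β * D.wordProd (q ++ m) = D.wordProd (A ++ (B ++ m)) :=
      D.exchange_del (A := A) (i := i) (B := B ++ m) hβ (by rw [e1]; simp) one_pos (by rw [one_smul]; exact he)
    have hlt : D.length (D.srefl β * D.wordProd q) < D.length (D.wordProd q) := by
      rw [hdel, ← hrq, e1]
      have := D.length_le (A ++ B)
      simp at this ⊢
      omega
    have hlt' : D.length (D.srefl β * D.wordProd (q ++ m)) < D.length (D.wordProd (q ++ m)) := by
      rw [hdel', ← hr, e1]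
      have := D.length_le (A ++ (B ++ m))
      simp at this ⊢
      omega
    refine ⟨hβ.1, hβ, ?_, D.bruhat_step hβ hlt', fun h => by rw [h] at hlt'; omega⟩
    obtain ⟨y, y1, y2, y3⟩ := D.exists_minR hpi' _ (D.srefl β * D.wordProd q) le_rfl
    obtain ⟨n, n1, rfl, n3⟩ := D.bruhat_subword (y3.trans (D.bruhat_step hβ hlt))
    obtain ⟨p1, p, p2, p3, p4⟩ := D.sublist_weak hpi' q n n1 hq n3 y1
    -- content of `p` is `β`
    have c1 := D.path_content p4
    have c2 : D.coroot β (D.act (D.wordProd q) pi') = -1 := by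
      rw [he, e1]; exact D.root_pairing (by rw [← e1]; exact hq)
    rw [← act_mul, p2, y2, act_mul, D.srefl_apply _ hβ.1, c2] at c1
    have c3 : D.content p = β := by
      have : D.content p = D.act (D.wordProd q) pi' - (-1 : ℚ) • β - D.act (D.wordProd q) pi' := by
        nth_rewrite 2 [c1]; abel
      rw [this]; module
    have w1 : D.wordProd (p ++ (n ++ m)) = D.wordProd (q ++ m) := by
      rw [wP_append, wP_append, wP_append, ← mul_assoc, p2]
    have r1 : D.Rd (p ++ (n ++ m)) := by
      unfold Rd at *
      rw [w1, ← hr]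
      simp
      omega
    have hp' := D.reduced_path' hpi hp r1 w1
    have hp1 := (D.isPath_append _ _ _).1 hp'
    have c4 := D.path_content hp1.2
    rw [← act_mul, ← wP_append, w1, c3] at c4
    have c5 : D.coroot β (D.act (D.wordProd (q ++ m)) pi) = -1 := by
      have := D.root_pairing (pi := pi) (A := A) (B := B ++ m) (i := i)
        (by rw [e1] at hp; simpa using hp)
      rw [he]
      rw [e1]
      simpa using this
    have c6 : D.act (D.wordProd (n ++ m)) pi = D.act (D.srefl β * D.wordProd (q ++ m)) pi := by
      rw [act_mul, D.srefl_apply _ hβ.1, c5, c4]; module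
    obtain ⟨z, z1, z2, z3⟩ := D.exists_minR hpi _ (D.srefl β * D.wordProd (q ++ m)) le_rfl
    have hz := D.minR_unique hpi z1 (D.path_minR hpi hp1.1) (by rw [z2, c6])
    rw [hz] at z3
    exact (D.bruhat_weak n m (D.rd_right r1)).trans z3

end WeylSetting

/-- **Skew Peterson formula (simply-laced form).** For a simply-laced Weyl
group and `π`-minuscule `v < w` with `w v⁻¹` `π'`-minuscule for some dominant
integral `π'`: `#Red(w v⁻¹) ⋅ ∏_{β ∈ S(w/v)} ht(β) = (ℓ(w) - ℓ(v))!`. -/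
theorem skew_peterson_formula
    (D : WeylSetting) (hsl : D.SimplyLaced)
    (pi : D.V) (hpi : D.IsDominant pi)
    (v w : D.W) (hv : D.IsMinuscule pi v) (hw : D.IsMinuscule pi w)
    (hvw : D.bruhatLT v w)
    (hmin : ∃ pi' : D.V, D.IsDominant pi' ∧ D.IsMinuscule pi' (w * v⁻¹)) :
    D.RedCard (w * v⁻¹) * ∏ β ∈ D.SsetSkew v w, D.ht β =
      (D.length w - D.length v).factorial := by
  obtain ⟨pi', hpi', hmin⟩ := hmin
  obtain ⟨lv, a1, rfl, a3⟩ := D.minuscule_path hv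
  obtain ⟨lw, b1, rfl, b3⟩ := D.minuscule_path hw
  obtain ⟨m, m1, m2, m3⟩ := D.bruhat_subword hvw.1
  obtain ⟨p1, q, p2, p3, p4⟩ := D.sublist_weak hpi lw m m1 b3 m3
    (by rw [m2]; exact D.path_minR hpi a3)
  have hp : D.IsPath (q ++ m) pi := (D.isPath_append _ _ _).2 ⟨p1, p4⟩
  have hwq : D.wordProd (q ++ m) = D.wordProd lw := by rw [D.wP_append, p2]
  have hr : D.Rd (q ++ m) := by
    unfold WeylSetting.Rd at *
    rw [hwq, ← b1]; simp; omega
  have hrq := D.rd_left hr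
  have hu : D.wordProd lw * (D.wordProd lv)⁻¹ = D.wordProd q := by
    rw [← p2, m2, mul_inv_cancel_right]
  rw [hu] at hmin ⊢
  obtain ⟨lu, u1, u2, u3⟩ := D.minuscule_path hmin
  have hq : D.IsPath q pi' := D.reduced_path' hpi' u3 hrq u2.symm
  have hset : D.SsetSkew (D.wordProd lv) (D.wordProd lw) = (D.rootsL q).toFinset := by
    ext β
    rw [← m2, ← hwq, D.skew_mem hpi hpi' hp hr hq, List.mem_toFinset]
  have hlen : D.length (D.wordProd lw) - D.length (D.wordProd lv) = q.length := by
    unfold WeylSetting.Rd at *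
    rw [m2] at m3
    omega
  rw [hset, hlen]
  have hP := D.peterson hpi' hq hrq
  rw [D.prodL_eq] at hP
  have hprod : ((D.rootsL q).map D.hf).prod =
      ((∏ β ∈ (D.rootsL q).toFinset, D.ht β : ℕ) : ℚ) := by
    rw [Nat.cast_prod, List.prod_toFinset _ (D.rootsL_nodup q hrq)]
    congr 1
    apply List.map_congr_left
    intro β hβ
    exact D.hf_eq_ht (D.rootsL_pos hrq hβ)
  rw [hprod] at hP
  exact_mod_cast hP.symm
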